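/- arXiv:math/0304218 — 2 statements merged into one kernel-verified Lean document; each statement's English description precedes it below -/
import Mathlib

section
/- Let K be an algebraically closed field with a surjective valuation deg : Kˣ → ℝ, and let I ⊆ K[x₁,…,xₙ] be an ideal. Then the following three subsets of ℝⁿ coincide: (a) the closure of the set {(deg u₁,…,deg uₙ) : u ∈ V(I)}, where V(I) = {u ∈ (Kˣ)ⁿ : f(u) = 0 for all f ∈ I}; (b) the intersection over all nonzero f ∈ I of the tropical hypersurfaces T(trop(f)); (c) the set of all w ∈ ℝⁿ such that the initial ideal in_w(I) contains no monomial. -/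
open scoped Classical

open MvPolynomial

/-- A surjective real valuation on a field `K`, recorded as a degree function `deg : K → ℝ`
(the value at `0` is irrelevant): `deg(ab) = deg a + deg b`, `deg(a+b) ≥ min (deg a) (deg b)`
whenever all three elements are nonzero, and every real number is the degree of some nonzero
element of `K`. -/
structure ValData (K : Type*) [Field K] where
  deg : K → ℝ
  deg_mul : ∀ a b : K, a ≠ 0 → b ≠ 0 → deg (a * b) = deg a + deg b
  deg_add : ∀ a b : K, a ≠ 0 → b ≠ 0 → a + b ≠ 0 → min (deg a) (deg b) ≤ deg (a + b)
  surj : ∀ r : ℝ, ∃ a : K, a ≠ 0 ∧ deg a = r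

variable {K : Type*} [Field K]

/-- The `w`-weight of the term of `f` with exponent vector `a`:
`deg(c_a) + ⟨a, w⟩` where `c_a` is the corresponding coefficient. -/
noncomputable def ValData.termWeight (V : ValData K) {n : ℕ} (w : Fin n → ℝ)
    (f : MvPolynomial (Fin n) K) (a : Fin n →₀ ℕ) : ℝ :=
  V.deg (f.coeff a) + a.sum fun i e => (e : ℝ) * w i

/-- The tropical hypersurface `T(trop f)` of a (nonzero) polynomial `f`: the set of `w ∈ ℝⁿ`
at which the minimum of the `w`-weights of the terms of `f` is attained at least twice. -/
def ValData.tropHyp (V : ValData K) {n : ℕ} (f : MvPolynomial (Fin n) K) :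
    Set (Fin n → ℝ) :=
  { w | ∃ a ∈ f.support, ∃ b ∈ f.support, a ≠ b ∧
      V.termWeight w f a = V.termWeight w f b ∧
      ∀ c ∈ f.support, V.termWeight w f a ≤ V.termWeight w f c }

lemma ValData.deg_one (V : ValData K) : V.deg 1 = 0 := by
  have h := V.deg_mul 1 1 one_ne_zero one_ne_zero
  rw [mul_one] at h; linarith

lemma ValData.deg_neg (V : ValData K) (a : K) (ha : a ≠ 0) : V.deg (-a) = V.deg a := by
  have h1 : V.deg ((-1 : K) * (-1)) = V.deg (-1) + V.deg (-1) :=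
    V.deg_mul _ _ (by norm_num) (by norm_num)
  rw [neg_mul_neg, one_mul, V.deg_one] at h1
  have h3 : V.deg ((-1 : K) * a) = V.deg (-1) + V.deg a := V.deg_mul _ _ (by norm_num) ha
  rw [neg_one_mul] at h3
  rw [h3]; linarith

/-- The valuation ring `R_K = { c ∈ K : c = 0 or deg c ≥ 0 }`. -/
def ValData.RK (V : ValData K) : Subring K where
  carrier := { c | c ≠ 0 → 0 ≤ V.deg c }
  zero_mem' := fun h => absurd rfl h
  one_mem' := fun _ => le_of_eq V.deg_one.symm
  add_mem' := by
    intro a b ha hb hab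
    by_cases h0 : a = 0
    · subst h0; rw [zero_add] at hab ⊢; exact hb hab
    by_cases h1 : b = 0
    · subst h1; rw [add_zero] at hab ⊢; exact ha hab
    calc (0 : ℝ) ≤ min (V.deg a) (V.deg b) := le_min (ha h0) (hb h1)
      _ ≤ V.deg (a + b) := V.deg_add a b h0 h1 hab
  mul_mem' := by
    intro a b ha hb hab
    have h0 : a ≠ 0 := left_ne_zero_of_mul hab
    have h1 : b ≠ 0 := right_ne_zero_of_mul hab
    rw [V.deg_mul a b h0 h1]
    exact add_nonneg (ha h0) (hb h1)
  neg_mem' := by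
    intro a ha h
    have h0 : a ≠ 0 := by simpa using h
    rw [V.deg_neg a h0]; exact ha h0

/-- The maximal ideal `M_K = { c ∈ R_K : c = 0 or deg c > 0 }` of the valuation ring. -/
def ValData.MK (V : ValData K) : Ideal V.RK where
  carrier := { c | (c : K) ≠ 0 → 0 < V.deg (c : K) }
  zero_mem' := by intro h; simp at h
  add_mem' := by
    rintro ⟨a, haR⟩ ⟨b, hbR⟩ ha hb hab
    simp only [Set.mem_setOf_eq, AddMemClass.mk_add_mk] at ha hb hab ⊢
    by_cases h0 : a = 0
    · subst h0; rw [zero_add] at hab ⊢; exact hb hab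
    by_cases h1 : b = 0
    · subst h1; rw [add_zero] at hab ⊢; exact ha hab
    have hab' : a + b ≠ 0 := hab
    calc (0 : ℝ) < min (V.deg a) (V.deg b) := lt_min (ha h0) (hb h1)
      _ ≤ V.deg (a + b) := V.deg_add a b h0 h1 hab'
  smul_mem' := by
    rintro ⟨r, hrR⟩ ⟨x, hxR⟩ hx h
    simp only [Set.mem_setOf_eq, smul_eq_mul] at hx h ⊢
    have hrx : r * x ≠ 0 := by simpa using h
    have h0 : r ≠ 0 := left_ne_zero_of_mul hrx
    have h1 : x ≠ 0 := right_ne_zero_of_mul hrx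
    have := V.deg_mul r x h0 h1
    simp only [Subring.coe_mul] at *
    rw [this]
    have := hrR h0
    have := hx h1
    linarith

/-- The residue field `k = R_K / M_K`. -/
abbrev ValData.kk (V : ValData K) : Type _ := V.RK ⧸ V.MK

/-- Reduction of an element of `K` modulo the maximal ideal `M_K` (defined to be `0` outside
the valuation ring). -/
noncomputable def ValData.res (V : ValData K) (c : K) : V.kk :=
  if h : c ∈ V.RK then Ideal.Quotient.mk V.MK ⟨c, h⟩ else 0

/-- Coefficientwise reduction of a polynomial with coefficients in `R_K ⊆ K` to a polynomial
over the residue field. -/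
noncomputable def ValData.reduce (V : ValData K) {n : ℕ} (f : MvPolynomial (Fin n) K) :
    MvPolynomial (Fin n) V.kk :=
  ∑ a ∈ f.support, monomial a (V.res (f.coeff a))

/-- The initial ideal `in_w(I) ⊆ k[x]`, where `k` is the residue field: it is generated by
the initial forms `in_w(f)` for `0 ≠ f ∈ I`.  Here, given `s₁, …, sₙ ∈ Kˣ` with
`deg sᵢ = wᵢ`, the initial form of `f` is the reduction modulo `M_K` of
`t⁻¹ · f(s₁x₁, …, sₙxₙ)` for any `t ∈ Kˣ` whose degree equals the minimal `w`-weight `ν` of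
a term of `f`. -/
noncomputable def ValData.inwIdeal (V : ValData K) {n : ℕ} (w : Fin n → ℝ)
    (s : Fin n → K) (I : Ideal (MvPolynomial (Fin n) K)) : Ideal (MvPolynomial (Fin n) V.kk) :=
  Ideal.span { g | ∃ f ∈ I, f ≠ 0 ∧ ∃ t : K, t ≠ 0 ∧
    (∀ a ∈ f.support, V.deg t ≤ V.termWeight w f a) ∧
    (∃ a ∈ f.support, V.deg t = V.termWeight w f a) ∧
    g = V.reduce (C t⁻¹ * (bind₁ fun i => C (s i) * (X i : MvPolynomial (Fin n) K)) f) }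

/-- A monomial: a nonzero scalar multiple of a product of variables. -/
def IsMonomial {σ : Type*} {R : Type*} [CommRing R] (g : MvPolynomial σ R) : Prop :=
  ∃ (a : σ →₀ ℕ) (c : R), c ≠ 0 ∧ g = monomial a c

set_option linter.style.haveILetI false
open Polynomial in
theorem tv_factor {K L Γ : Type} [Field K] [IsAlgClosed K] [Field L] [Algebra K L]
    [LinearOrderedCommGroupWithZero Γ] (v : Valuation L Γ) (y : L) (a0 : K) (γ : Γ) (S : Finset K)
    (h0 : v (y - algebraMap K L a0) = γ)
    (hS : ∀ a ∈ S, v (y - algebraMap K L a) ≠ γ →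
      v (y - algebraMap K L a) = v (algebraMap K L (a0 - a)))
    (p : K[X]) (hp : p ≠ 0) (hr : ∀ r ∈ p.roots, r ∈ S) :
    ∃ α : K, α ≠ 0 ∧ ∃ m : ℕ, v (Polynomial.aeval y p) = v (algebraMap K L α) * γ ^ m ∧
      ∀ d : K, (∀ a ∈ S, (v (y - algebraMap K L a) = γ →
          v (algebraMap K L (a0 + d - a)) = v (algebraMap K L d)) ∧
        (v (y - algebraMap K L a) ≠ γ →
          v (algebraMap K L (a0 + d - a)) = v (algebraMap K L (a0 - a)))) →
        v (algebraMap K L (p.eval (a0 + d))) = v (algebraMap K L α) * v (algebraMap K L d) ^ m := by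
  have key : ∀ s : Multiset K, (∀ r ∈ s, r ∈ S) →
    ∃ α : K, α ≠ 0 ∧ ∃ m : ℕ, v (Polynomial.aeval y (s.map (fun r => Polynomial.X - Polynomial.C r)).prod)
        = v (algebraMap K L α) * γ ^ m ∧
      ∀ d : K, (∀ a ∈ S, (v (y - algebraMap K L a) = γ →
          v (algebraMap K L (a0 + d - a)) = v (algebraMap K L d)) ∧
        (v (y - algebraMap K L a) ≠ γ →
          v (algebraMap K L (a0 + d - a)) = v (algebraMap K L (a0 - a)))) →
        v (algebraMap K L ((s.map (fun r => Polynomial.X - Polynomial.C r)).prod.eval (a0 + d)))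
          = v (algebraMap K L α) * v (algebraMap K L d) ^ m := by
    intro s
    induction s using Multiset.induction with
    | empty => intro _; exact ⟨1, one_ne_zero, 0, by simp, by simp⟩
    | cons r s ih =>
      intro hs
      obtain ⟨α, hα, m, h1, h2⟩ := ih (fun r hr => hs r (Multiset.mem_cons_of_mem hr))
      have hrS := hs r (Multiset.mem_cons_self r s)
      by_cases hc : v (y - algebraMap K L r) = γ
      · refine ⟨α, hα, m + 1, ?_, ?_⟩
        · simp only [Multiset.map_cons, Multiset.prod_cons, map_mul, h1, map_sub, Polynomial.aeval_X, Polynomial.aeval_C,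
            hc, pow_succ]
          rw [mul_comm, mul_assoc]
        · intro d hd
          simp only [Multiset.map_cons, Multiset.prod_cons, Polynomial.eval_mul, map_mul, h2 d hd, Polynomial.eval_sub,
            Polynomial.eval_X, Polynomial.eval_C, (hd r hrS).1 hc, pow_succ]
          rw [mul_comm, mul_assoc]
      · refine ⟨(a0 - r) * α, mul_ne_zero ?_ hα, m, ?_, ?_⟩
        · intro h
          have : a0 = r := sub_eq_zero.1 h
          exact hc (this ▸ h0)
        · simp only [Multiset.map_cons, Multiset.prod_cons, map_mul, h1]
          rw [map_sub, Polynomial.aeval_X, Polynomial.aeval_C, hS r hrS hc, mul_assoc]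
        · intro d hd
          simp only [Multiset.map_cons, Multiset.prod_cons, Polynomial.eval_mul, map_mul, h2 d hd]
          rw [Polynomial.eval_sub, Polynomial.eval_X, Polynomial.eval_C, (hd r hrS).2 hc, mul_assoc]
  obtain ⟨α, hα, m, h1, h2⟩ := key p.roots hr
  have hsplit : p = Polynomial.C p.leadingCoeff * (p.roots.map (fun r => Polynomial.X - Polynomial.C r)).prod :=
    (IsAlgClosed.splits p).eq_prod_roots
  refine ⟨p.leadingCoeff * α, mul_ne_zero (leadingCoeff_ne_zero.2 hp) hα, m, ?_, ?_⟩
  · conv_lhs => rw [hsplit]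
    rw [map_mul, map_mul, h1, Polynomial.aeval_C, map_mul, map_mul, mul_assoc]
  · intro d hd
    conv_lhs => rw [hsplit]
    rw [Polynomial.eval_mul, map_mul, map_mul, h2 d hd, Polynomial.eval_C, map_mul, map_mul, mul_assoc]

/-- cut lemma -/
theorem tv_cut {K Γ : Type} [Field K] [IsAlgClosed K]
    [LinearOrderedCommGroupWithZero Γ] (v : Valuation K Γ) (a : K) (ha : 1 < v a) (γ : Γ)
    (hγ0 : γ ≠ 0) (E : Finset K) :
    ∃ d : K, d ≠ 0 ∧ ∀ b ∈ E, (γ < v b → v d < v b) ∧ (v b < γ → v b < v d) := by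
  have hγ : 0 < γ := zero_lt_iff.2 hγ0
  have ha0 : a ≠ 0 := by rintro rfl; simp at ha
  obtain ⟨b1, hb1, hm1⟩ := ((insert 0 E).filter (fun b => v b < γ)).exists_max_image v
    ⟨0, by simp [hγ]⟩
  simp only [Finset.mem_filter, Finset.mem_insert] at hb1 hm1
  by_cases hne : (E.filter (fun b => γ < v b)).Nonempty
  · obtain ⟨b2, hb2, hm2⟩ := (E.filter (fun b => γ < v b)).exists_min_image v hne
    simp only [Finset.mem_filter] at hb2 hm2
    have h12 : v b1 < v b2 := hb1.2.trans hb2.2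
    have hb20 : 0 < v b2 := hγ.trans hb2.2
    suffices ∃ d : K, d ≠ 0 ∧ v b1 < v d ∧ v d < v b2 by
      obtain ⟨d, hd0, h1, h2⟩ := this
      exact ⟨d, hd0, fun b hb => ⟨fun h => h2.trans_le (hm2 b ⟨hb, h⟩),
        fun h => (hm1 b ⟨Or.inr hb, h⟩).trans_lt h1⟩⟩
    by_cases hz : b1 = 0
    · refine ⟨b2 * a⁻¹, mul_ne_zero ?_ (inv_ne_zero ha0), ?_, ?_⟩
      · rintro rfl; simp at hb20
      · subst hz
        rw [map_zero, zero_lt_iff]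
        simp [ha0]; rintro rfl; simp at hb20
      · rw [map_mul, map_inv₀]
        exact mul_lt_of_lt_one_right hb20 (inv_lt_one_of_one_lt₀ ha)
    · obtain ⟨d, hd⟩ := IsAlgClosed.exists_pow_nat_eq (b1 * b2) (n := 2) (by norm_num)
      have hb1p : 0 < v b1 := zero_lt_iff.2 (by simpa using hz)
      have hvd : v d * v d = v b1 * v b2 := by rw [← map_mul, ← map_mul, ← hd, sq]
      refine ⟨d, ?_, ?_, ?_⟩
      · rintro rfl
        rw [map_zero, mul_zero] at hvd
        exact (mul_pos hb1p hb20).ne hvd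
      · by_contra h
        push Not at h
        have := mul_le_mul' h h
        rw [hvd] at this
        exact absurd (mul_lt_mul_of_pos_left h12 hb1p) (not_lt.2 this)
      · by_contra h
        push Not at h
        have := mul_le_mul' h h
        rw [hvd] at this
        exact absurd (mul_lt_mul_of_pos_right h12 hb20) (not_lt.2 this)
  · have hE : ∀ b ∈ E, ¬ γ < v b := by
      intro b hb h; exact hne ⟨b, by simp [hb, h]⟩
    suffices ∃ d : K, d ≠ 0 ∧ v b1 < v d by
      obtain ⟨d, hd0, h1⟩ := this
      exact ⟨d, hd0, fun b hb => ⟨fun h => absurd h (hE b hb),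
        fun h => (hm1 b ⟨Or.inr hb, h⟩).trans_lt h1⟩⟩
    by_cases hz : b1 = 0
    · exact ⟨1, one_ne_zero, by simp [hz]⟩
    · have hb1p : 0 < v b1 := zero_lt_iff.2 (by simpa using hz)
      exact ⟨b1 * a, mul_ne_zero hz ha0, by
        rw [map_mul]; exact lt_mul_of_one_lt_right hb1p ha⟩

open Polynomial in
theorem tv_C {K L Γ : Type} [Field K] [IsAlgClosed K] [Field L] [Algebra K L]
    [LinearOrderedCommGroupWithZero Γ] (v : Valuation L Γ) (y : L)
    (hy : ∀ a : K, y ≠ algebraMap K L a) (a : K) (ha : 1 < v (algebraMap K L a))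
    (G : Finset (K[X] × K[X]))
    (hG : ∀ g ∈ G, g.2 ≠ 0 ∧ v (Polynomial.aeval y g.1) ≤ v (Polynomial.aeval y g.2)) :
    ∃ c : K, ∀ g ∈ G, g.2.eval c ≠ 0 ∧
      v (algebraMap K L (g.1.eval c)) ≤ v (algebraMap K L (g.2.eval c)) := by
  set S : Finset K := insert 0 (G.biUnion (fun g => g.1.roots.toFinset ∪ g.2.roots.toFinset))
    with hSdef
  obtain ⟨a0, ha0, hmin⟩ := S.exists_min_image (fun a => v (y - algebraMap K L a)) ⟨0, by simp [S]⟩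
  set γ := v (y - algebraMap K L a0) with hγ
  have hγ0 : γ ≠ 0 := by
    rw [hγ, Valuation.ne_zero_iff]; exact sub_ne_zero.2 (hy a0)
  have hdiff : ∀ b : K, algebraMap K L (a0 - b) = (y - algebraMap K L b) - (y - algebraMap K L a0) := by
    intro b; rw [map_sub]; ring
  have hS2 : ∀ a ∈ S, v (y - algebraMap K L a) ≠ γ →
      v (y - algebraMap K L a) = v (algebraMap K L (a0 - a)) := by
    intro b hb hne
    rw [hdiff, Valuation.map_sub_swap v (y - algebraMap K L b) (y - algebraMap K L a0)]
    exact (Valuation.map_sub_eq_of_lt_right v (lt_of_le_of_ne (hmin b hb) (Ne.symm hne))).symm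
  have hS1 : ∀ a ∈ S, v (y - algebraMap K L a) = γ → v (algebraMap K L (a0 - a)) ≤ γ := by
    intro b hb he
    rw [hdiff]
    exact (v.map_sub _ _).trans (by rw [he]; simp [γ])
  have hroots : ∀ g ∈ G, (∀ r ∈ g.1.roots, r ∈ S) ∧ (∀ r ∈ g.2.roots, r ∈ S) := by
    intro g hg
    constructor
    all_goals
      intro r hr
      simp only [S, Finset.mem_insert, Finset.mem_biUnion, Finset.mem_union, Multiset.mem_toFinset]
      exact Or.inr ⟨g, hg, by simp only [hr, true_or, or_true]⟩
  have hfac := fun p hp hr => tv_factor v y a0 γ S hγ.symm hS2 p hp hr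
  -- reduce to finding d
  suffices ∃ d : K, d ≠ 0 ∧ (∀ a ∈ S, (v (y - algebraMap K L a) = γ →
          v (algebraMap K L (a0 + d - a)) = v (algebraMap K L d)) ∧
        (v (y - algebraMap K L a) ≠ γ →
          v (algebraMap K L (a0 + d - a)) = v (algebraMap K L (a0 - a)))) ∧
        (∀ g ∈ G, ∀ (h1 : g.1 ≠ 0) (h2 : g.2 ≠ 0) (r1 : ∀ r ∈ g.1.roots, r ∈ S)
          (r2 : ∀ r ∈ g.2.roots, r ∈ S),
          v (algebraMap K L (hfac g.1 h1 r1).choose) *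
              v (algebraMap K L d) ^ (hfac g.1 h1 r1).choose_spec.2.choose ≤
          v (algebraMap K L (hfac g.2 h2 r2).choose) *
              v (algebraMap K L d) ^ (hfac g.2 h2 r2).choose_spec.2.choose) by
    obtain ⟨d, hd0, hd, hd2⟩ := this
    refine ⟨a0 + d, fun g hg => ?_⟩
    obtain ⟨h2, hle⟩ := hG g hg
    obtain ⟨r1, r2⟩ := hroots g hg
    have e2 := (hfac g.2 h2 r2).choose_spec.2.choose_spec.2 d hd
    constructor
    · intro h
      rw [h, map_zero, map_zero] at e2
      have := (hfac g.2 h2 r2).choose_spec.1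
      have h3 : v (algebraMap K L d) ≠ 0 := by simpa using hd0
      refine absurd e2.symm (mul_ne_zero (by simpa using this) (pow_ne_zero _ h3))
    · by_cases h1 : g.1 = 0
      · simp [h1]
      · have e1 := (hfac g.1 h1 r1).choose_spec.2.choose_spec.2 d hd
        rw [e1, e2]
        exact hd2 g hg h1 h2 r1 r2
  by_cases hA : ∃ d0 : K, v (algebraMap K L d0) = γ
  · obtain ⟨d0, hd0⟩ := hA
    set S1 := S.filter (fun a => v (y - algebraMap K L a) = γ) with hS1d
    have ha0S1 : a0 ∈ S1 := by simp [S1, ha0, hγ]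
    have hcard : 0 < S1.card := Finset.card_pos.2 ⟨a0, ha0S1⟩
    obtain ⟨c, hc⟩ := IsAlgClosed.exists_root (∏ a ∈ S1, (Polynomial.X - Polynomial.C a) - Polynomial.C (d0 ^ S1.card)) (by
      rw [degree_sub_C]
      · rw [degree_prod]; simp; exact Finset.nonempty_iff_ne_empty.1 ⟨a0, ha0S1⟩
      · rw [degree_prod]; simp; exact ⟨a0, ha0S1⟩)
    have hprod : ∏ a ∈ S1, v (algebraMap K L (c - a)) = γ ^ S1.card := by
      have : ∏ a ∈ S1, (c - a) = d0 ^ S1.card := by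
        have := hc
        simp only [IsRoot.def, Polynomial.eval_sub, Polynomial.eval_prod, Polynomial.eval_X, Polynomial.eval_C] at this
        exact sub_eq_zero.1 (by simpa using this)
      rw [← hd0, ← map_pow, ← map_pow, ← this, map_prod, map_prod]
    have hsub : ∀ b : K, algebraMap K L (c - b) = algebraMap K L (c - a0) + algebraMap K L (a0 - b) := by
      intro b; rw [← map_add]; congr 1; ring
    have hle0 : v (algebraMap K L (c - a0)) ≤ γ := by
      by_contra h
      push Not at h
      have : ∀ b ∈ S1, v (algebraMap K L (c - b)) = v (algebraMap K L (c - a0)) := by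
        intro b hb
        simp only [S1, Finset.mem_filter] at hb
        rw [hsub]
        exact Valuation.map_add_eq_of_lt_left v ((hS1 b hb.1 hb.2).trans_lt h)
      rw [Finset.prod_congr rfl this, Finset.prod_const] at hprod
      exact absurd hprod (pow_lt_pow_left₀ h zero_le hcard.ne').ne'
    have hle1 : ∀ b ∈ S1, v (algebraMap K L (c - b)) ≤ γ := by
      intro b hb
      simp only [S1, Finset.mem_filter] at hb
      rw [hsub]
      exact (v.map_add _ _).trans (max_le hle0 (hS1 b hb.1 hb.2))
    have heq1 : ∀ b ∈ S1, v (algebraMap K L (c - b)) = γ := by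
      intro b hb
      by_contra hne
      have hlt := lt_of_le_of_ne (hle1 b hb) hne
      rw [← Finset.mul_prod_erase _ _ hb] at hprod
      have h2 : ∏ x ∈ S1.erase b, v (algebraMap K L (c - x)) ≤ γ ^ (S1.erase b).card :=
        (Finset.prod_le_prod' (fun i hi => hle1 i (Finset.mem_of_mem_erase hi))).trans
          (by rw [Finset.prod_const])
      have h3 : γ ^ S1.card = γ * γ ^ (S1.erase b).card := by
        rw [← pow_succ', Finset.card_erase_add_one hb]
      have h4 : v (algebraMap K L (c - b)) * ∏ x ∈ S1.erase b, v (algebraMap K L (c - x))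
          < γ * γ ^ (S1.erase b).card := by
        refine (mul_le_mul_right h2 _).trans_lt ?_
        exact mul_lt_mul_of_pos_right hlt (zero_lt_iff.2 (pow_ne_zero _ hγ0))
      rw [hprod, h3] at h4
      exact lt_irrefl _ h4
    have hvd : v (algebraMap K L (c - a0)) = γ := heq1 a0 ha0S1
    refine ⟨c - a0, ?_, ?_, ?_⟩
    · intro h; rw [h, map_zero, map_zero] at hvd; exact hγ0 hvd.symm
    · intro b hb
      rw [add_sub_cancel]
      refine ⟨fun h => ?_, fun h => ?_⟩
      · rw [hvd]; exact heq1 b (by simp [S1, hb, h])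
      · rw [hsub]
        refine Valuation.map_add_eq_of_lt_right v ?_
        rw [hvd, ← hS2 b hb h]
        exact lt_of_le_of_ne (hmin b hb) (Ne.symm h)
    · intro g hg h1 h2 r1 r2
      rw [hvd, ← (hfac g.1 h1 r1).choose_spec.2.choose_spec.1,
        ← (hfac g.2 h2 r2).choose_spec.2.choose_spec.1]
      exact (hG g hg).2
  · push Not at hA
    -- thresholds
    have hthr : ∀ α β : K, α ≠ 0 → β ≠ 0 → ∀ m l : ℕ, ∃ b : K, ∀ d : K,
        (γ < v (algebraMap K L b) → v (algebraMap K L d) < v (algebraMap K L b)) →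
        (v (algebraMap K L b) < γ → v (algebraMap K L b) < v (algebraMap K L d)) →
        v (algebraMap K L α) * γ ^ m ≤ v (algebraMap K L β) * γ ^ l →
        v (algebraMap K L α) * v (algebraMap K L d) ^ m ≤
          v (algebraMap K L β) * v (algebraMap K L d) ^ l := by
      intro α β hα hβ m l
      have hα' : 0 < v (algebraMap K L α) := zero_lt_iff.2 (by simpa using hα)
      have hβ' : 0 < v (algebraMap K L β) := zero_lt_iff.2 (by simpa using hβ)
      rcases lt_trichotomy m l with h | h | h
      · obtain ⟨k, rfl⟩ := Nat.exists_eq_add_of_lt h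
        obtain ⟨b, hb⟩ := IsAlgClosed.exists_pow_nat_eq (α / β) (n := k + 1) (by omega)
        have hαb : α = β * b ^ (k + 1) := by rw [hb]; field_simp
        refine ⟨b, fun d _ hd2 hle => ?_⟩
        have e : ∀ x : Γ, v (algebraMap K L β) * x ^ (m + k + 1)
          = (v (algebraMap K L β) * x ^ (k+1)) * x ^ m := by
          intro x; rw [mul_assoc, ← pow_add]; congr 2; omega
        rw [e] at hle ⊢
        have h1 : v (algebraMap K L b) ≤ γ := by
          have := le_of_mul_le_mul_right hle (zero_lt_iff.2 (pow_ne_zero _ hγ0))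
          rw [hαb, map_mul, map_mul, map_pow, map_pow] at this
          exact le_of_pow_le_pow_left₀ (by omega) zero_le (le_of_mul_le_mul_left this hβ')
        have h2 := hd2 (lt_of_le_of_ne h1 (hA b))
        gcongr ?_ * _
        rw [hαb, map_mul, map_mul, map_pow, map_pow]
        gcongr
      · subst h
        refine ⟨0, fun d _ _ hle => ?_⟩
        have := le_of_mul_le_mul_right hle (zero_lt_iff.2 (pow_ne_zero _ hγ0))
        gcongr
      · obtain ⟨k, rfl⟩ := Nat.exists_eq_add_of_lt h
        obtain ⟨b, hb⟩ := IsAlgClosed.exists_pow_nat_eq (β / α) (n := k + 1) (by omega)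
        have hαb : β = α * b ^ (k + 1) := by rw [hb]; field_simp
        refine ⟨b, fun d hd1 _ hle => ?_⟩
        have e : ∀ x : Γ, v (algebraMap K L α) * x ^ (l + k + 1)
          = (v (algebraMap K L α) * x ^ (k+1)) * x ^ l := by
          intro x; rw [mul_assoc, ← pow_add]; congr 2; omega
        rw [e] at hle ⊢
        have h1 : γ ≤ v (algebraMap K L b) := by
          have := le_of_mul_le_mul_right hle (zero_lt_iff.2 (pow_ne_zero _ hγ0))
          rw [hαb, map_mul, map_mul, map_pow, map_pow] at this
          exact le_of_pow_le_pow_left₀ (by omega) zero_le (le_of_mul_le_mul_left this hα')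
        have h2 := hd1 (lt_of_le_of_ne h1 (hA b).symm)
        gcongr ?_ * _
        rw [hαb, map_mul, map_mul, map_pow, map_pow]
        gcongr
    choose! B hB using hthr
    let thr : K[X] × K[X] → K := fun g =>
      if h : (g.1 ≠ 0 ∧ g.2 ≠ 0) ∧ (∀ r ∈ g.1.roots, r ∈ S) ∧ (∀ r ∈ g.2.roots, r ∈ S) then
        B (hfac g.1 h.1.1 h.2.1).choose (hfac g.2 h.1.2 h.2.2).choose
          (hfac g.1 h.1.1 h.2.1).choose_spec.2.choose (hfac g.2 h.1.2 h.2.2).choose_spec.2.choose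
      else 0
    obtain ⟨d, hd0, hd⟩ := tv_cut (v.comap (algebraMap K L)) a ha γ hγ0
      (S.image (fun a => a0 - a) ∪ G.image thr)
    simp only [Valuation.comap_apply] at hd
    have hsub : ∀ b : K, algebraMap K L (a0 + d - b) = algebraMap K L d + algebraMap K L (a0 - b) := by
      intro b; rw [← map_add]; congr 1; ring
    refine ⟨d, hd0, ?_, ?_⟩
    · intro b hb
      have hb' := hd (a0 - b) (Finset.mem_union_left _ (Finset.mem_image_of_mem _ hb))
      refine ⟨fun h => ?_, fun h => ?_⟩
      · rw [hsub]
        exact Valuation.map_add_eq_of_lt_left v (hb'.2 (lt_of_le_of_ne (hS1 b hb h) (hA _)))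
      · rw [hsub]
        refine Valuation.map_add_eq_of_lt_right v (hb'.1 ?_)
        rw [← hS2 b hb h]
        exact lt_of_le_of_ne (hmin b hb) (Ne.symm h)
    · intro g hg h1 h2 r1 r2
      have hb' := hd (thr g) (Finset.mem_union_right _ (Finset.mem_image_of_mem _ hg))
      have ht : thr g = B (hfac g.1 h1 r1).choose (hfac g.2 h2 r2).choose
          (hfac g.1 h1 r1).choose_spec.2.choose (hfac g.2 h2 r2).choose_spec.2.choose :=
        dif_pos ⟨⟨h1, h2⟩, r1, r2⟩
      rw [ht] at hb'
      refine hB _ _ (hfac g.1 h1 r1).choose_spec.1 (hfac g.2 h2 r2).choose_spec.1 _ _ d hb'.1 hb'.2 ?_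
      rw [← (hfac g.1 h1 r1).choose_spec.2.choose_spec.1,
        ← (hfac g.2 h2 r2).choose_spec.2.choose_spec.1]
      exact (hG g hg).2
theorem tv_P0 {K L : Type} [Field K] [Field L] (N : Subring L) (π0 : N →+* K)
    (hN : ∀ z : L, IsIntegral N z → z ∈ N) :
    ∃ (U : Subring L) (π : U →+* K), (∀ z : N, ∃ h : (z : L) ∈ U, π ⟨z, h⟩ = π0 z) ∧
      (∀ z : U, π z ≠ 0 → (z : L)⁻¹ ∈ U) ∧
      (∀ z : L, IsIntegral U z → z ∈ U) := by
  let P : Ideal N := RingHom.ker π0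
  haveI : P.IsPrime := RingHom.ker_isPrime π0
  obtain ⟨U, inst, hNU, hloc, htow, halg⟩ : ∃ (U : Subring L) (_ : Algebra N U) (hNU : N ≤ U),
      IsLocalization.AtPrime U P ∧ IsScalarTower N U L ∧
        ∀ z : N, algebraMap N U z = ⟨z, hNU z.2⟩ :=
    ⟨(LocalSubring.ofPrime N P).toSubring, inferInstance, LocalSubring.le_ofPrime N P,
      inferInstance, inferInstance, fun z => rfl⟩
  have hunit : ∀ s : P.primeCompl, IsUnit (π0 s) := by
    intro s
    exact isUnit_iff_ne_zero.2 s.2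
  have hsne : ∀ s : P.primeCompl, ((s : N) : L) ≠ 0 := by
    intro s h
    have : (s : N) = 0 := Subtype.ext h
    exact s.2 (by rw [this]; exact P.zero_mem)
  obtain ⟨π, hπ⟩ : ∃ π : U →+* K, ∀ z : N, π ⟨z, hNU z.2⟩ = π0 z :=
    ⟨IsLocalization.lift (M := P.primeCompl) hunit, fun z => by
      rw [← halg]
      exact IsLocalization.lift_eq (M := P.primeCompl) hunit z⟩
  have hs : ∀ s : N, π0 s ≠ 0 → (s : L)⁻¹ ∈ U := by
    intro s hs
    have h1 := IsLocalization.map_units U (⟨s, hs⟩ : P.primeCompl)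
    rw [halg] at h1
    obtain ⟨t, ht⟩ := h1.exists_right_inv
    have h2 : (s : L) * (t : L) = 1 := congrArg Subtype.val ht
    rw [inv_eq_of_mul_eq_one_right h2]
    exact t.2
  refine ⟨U, π, fun z => ⟨hNU z.2, hπ z⟩, ?_, ?_⟩
  · intro z hz
    obtain ⟨⟨t, s⟩, hts⟩ := IsLocalization.surj P.primeCompl z
    rw [halg, halg] at hts
    have h1 : (z : L) * ((s : N) : L) = (t : L) := congrArg Subtype.val hts
    have h2 : π z * π0 s = π0 t := by
      have := congrArg π hts
      rw [map_mul, hπ, hπ] at this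
      exact this
    have ht : π0 t ≠ 0 := by
      rw [← h2]; exact mul_ne_zero hz s.2
    have : (z : L)⁻¹ = (t : L)⁻¹ * ((s : N) : L) := by
      rw [← h1, mul_inv, mul_assoc, inv_mul_cancel₀ (hsne s), mul_one]
    rw [this]
    exact U.mul_mem (hs t ht) (hNU (s : N).2)
  · intro z hz
    obtain ⟨m, hm⟩ := IsIntegral.exists_multiple_integral_of_isLocalization P.primeCompl z hz
    have hmz : (m : N) • z ∈ N := hN _ hm
    have h5 : z = ((m : N) • z) * ((m : N) : L)⁻¹ := by
      rw [Subring.smul_def, smul_eq_mul, mul_right_comm, mul_inv_cancel₀ (hsne m), one_mul]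
    rw [h5]
    exact U.mul_mem (hNU hmz) (hs _ m.2)

open Polynomial in
theorem tv_P {K L : Type} [Field K] [IsAlgClosed K] [Field L] [Algebra K L] (y : L)
    (hy : Transcendental K y) (c : K) :
    ∃ (U : Subring L) (π : U →+* K), (∀ a : K, ∃ h : algebraMap K L a ∈ U, π ⟨_, h⟩ = a) ∧
      (∃ h : y ∈ U, π ⟨y, h⟩ = c) ∧ (∀ z : U, π z ≠ 0 → (z : L)⁻¹ ∈ U) ∧
      (∀ z : L, IsIntegral U z → z ∈ U) := by
  letI : Algebra K[X] L := (Polynomial.aeval y).toAlgebra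
  have hmap : ∀ p : K[X], algebraMap K[X] L p = Polynomial.aeval y p := fun p => rfl
  have hinj : Function.Injective (algebraMap K[X] L) := by
    rw [transcendental_iff_injective] at hy; exact hy
  have hinjN : Function.Injective (algebraMap K[X] (integralClosure K[X] L)) := by
    intro p q h
    exact hinj (congrArg (fun z : integralClosure K[X] L => (z : L)) h)
  have hmax : (Ideal.span {Polynomial.X - Polynomial.C c} : Ideal K[X]).IsMaximal :=
    PrincipalIdealRing.isMaximal_of_irreducible (irreducible_X_sub_C c)
  obtain ⟨n, hn, hnc⟩ := Ideal.exists_ideal_over_maximal_of_isIntegral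
    (S := integralClosure K[X] L) (Ideal.span {Polynomial.X - Polynomial.C c} : Ideal K[X]) (by
      rw [(RingHom.injective_iff_ker_eq_bot _).1 hinjN]; exact bot_le)
  have hcmem : ∀ p : K[X], Ideal.Quotient.mk n (algebraMap K[X] _ p)
      = Ideal.Quotient.mk n (algebraMap K[X] _ (Polynomial.C (p.eval c))) := by
    intro p
    rw [Ideal.Quotient.eq, ← map_sub, ← Ideal.mem_comap, hnc, Ideal.mem_span_singleton]
    rw [dvd_iff_isRoot]; simp
  letI : Algebra K (integralClosure K[X] L ⧸ n) :=
    ((Ideal.Quotient.mk n).comp ((algebraMap K[X] (integralClosure K[X] L)).comp Polynomial.C)).toAlgebra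
  have halg : ∀ a : K, algebraMap K (integralClosure K[X] L ⧸ n) a =
    Ideal.Quotient.mk n (algebraMap K[X] _ (Polynomial.C a)) := fun a => rfl
  haveI : Algebra.IsIntegral K (integralClosure K[X] L ⧸ n) := by
    constructor
    intro z
    obtain ⟨z, rfl⟩ := Ideal.Quotient.mk_surjective z
    obtain ⟨P, hP, hPz⟩ := integralClosure.isIntegral z
    refine ⟨P.map (evalRingHom c), hP.map _, ?_⟩
    rw [Polynomial.eval₂_map]
    have : (algebraMap K (integralClosure K[X] L ⧸ n)).comp (evalRingHom c)
      = (Ideal.Quotient.mk n).comp (algebraMap K[X] (integralClosure K[X] L)) := by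
      ext1
      · ext a; simp [halg]
      · have := hcmem Polynomial.X
        simp only [RingHom.comp_apply, halg, coe_evalRingHom]
        exact this.symm
    rw [this, ← Polynomial.hom_eval₂, hPz, map_zero]
  have hbij : Function.Bijective (algebraMap K (integralClosure K[X] L ⧸ n)) := by
    haveI : IsDomain (integralClosure K[X] L ⧸ n) := by infer_instance
    exact IsAlgClosed.algebraMap_bijective_of_isIntegral
  let ε : K ≃+* (integralClosure K[X] L ⧸ n) := RingEquiv.ofBijective _ hbij
  let N : Subring L := (integralClosure K[X] L).toSubring
  let π0 : N →+* K := (ε.symm : (integralClosure K[X] L ⧸ n) →+* K).comp (Ideal.Quotient.mk n)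
  have hpoly : ∀ p : K[X], Polynomial.aeval y p ∈ N := fun p =>
    (integralClosure K[X] L).algebraMap_mem p
  have hπ0 : ∀ p : K[X], π0 ⟨Polynomial.aeval y p, hpoly p⟩ = p.eval c := by
    intro p
    show ε.symm (Ideal.Quotient.mk n (algebraMap K[X] _ p)) = _
    rw [hcmem, ← halg]
    exact ε.symm_apply_apply _
  obtain ⟨U, π, h1, h2, h3⟩ := tv_P0 N π0 (fun z hz => by
    have h3 : IsIntegral (integralClosure K[X] L) z := hz
    have h4 : IsIntegral K[X] z := isIntegral_trans _ h3
    exact h4)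
  have h4 : ∀ p : K[X], ∃ h : Polynomial.aeval y p ∈ U, π ⟨_, h⟩ = p.eval c := by
    intro p
    obtain ⟨h, e⟩ := h1 ⟨_, hpoly p⟩
    exact ⟨h, e.trans (hπ0 p)⟩
  refine ⟨U, π, ?_, ?_, h2, h3⟩
  · intro a
    simpa only [Polynomial.aeval_C, Polynomial.eval_C] using h4 (Polynomial.C a)
  · simpa only [Polynomial.aeval_X, Polynomial.eval_X] using h4 Polynomial.X
theorem tv_integral_of_val {L : Type} [Field L] (A : Subring L) (z : L)
    (h : ∀ B : ValuationSubring L, A ≤ B.toSubring → z ∈ B) : IsIntegral A z := by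
  have h1 : z ∈ (⨅ V : {V : ValuationSubring L // (A : Set L) ⊆ V.toSubring}, V.1.toSubring) := by
    rw [Subring.mem_iInf]
    rintro ⟨B, hB⟩
    exact h B hB
  rw [iInf_valuationSubring_superset] at h1
  have h2 : IsIntegral (Subring.closure (A : Set L)) z := h1
  rwa [Subring.closure_eq] at h2

open Polynomial in
theorem tv_E {L : Type} [Field L] (O : ValuationSubring L) (F : Subring L)
    (hF : ∀ a ∈ F, a⁻¹ ∈ F) (x : L) (hx : x ∈ O)
    (p : L[X]) (hp : p ≠ 0) (hpF : ∀ i, p.coeff i ∈ F) (hpx : p.eval x = 0) :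
    ∃ e : L, e ∈ O ∧ e⁻¹ ∈ O ∧ e ≠ 0 ∧ IsIntegral (O.toSubring ⊓ F : Subring L) e ∧
      IsIntegral (O.toSubring ⊓ F : Subring L) (e * x) := by
  set v := O.valuation with hv
  obtain ⟨j, hj, hjmax⟩ := p.support.exists_max_image
    (fun i => toLex (v (p.coeff i), i)) (by simpa using hp)
  have haj : p.coeff j ≠ 0 := by simpa using hj
  set b : ℕ → L := fun i => p.coeff i / p.coeff j with hb
  have hmax : ∀ i, i ≠ j → v (b i) ≤ 1 ∧ (j < i → v (b i) < 1) := by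
    intro i hij
    have hvj : 0 < v (p.coeff j) := zero_lt_iff.2 (by simpa using haj)
    by_cases hi : i ∈ p.support
    · have := hjmax i hi
      rw [Prod.Lex.le_iff] at this
      simp only [ofLex_toLex] at this
      simp only [b, map_div₀]
      rcases this with h | ⟨h, h'⟩
      · have : v (p.coeff i) / v (p.coeff j) < 1 := (div_lt_one₀ hvj).2 h
        exact ⟨this.le, fun _ => this⟩
      · exact ⟨by rw [h, div_self hvj.ne'], fun h2 => by omega⟩
    · have : p.coeff i = 0 := by simpa using hi
      simp [b, this]
  have hbj : b j = 1 := div_self haj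
  have hble : ∀ i, v (b i) ≤ 1 := by
    intro i
    by_cases h : i = j
    · rw [h, hbj, map_one]
    · exact (hmax i h).1
  have hbA : ∀ i, b i ∈ (O.toSubring ⊓ F : Subring L) := by
    intro i
    refine ⟨(O.valuation_le_one_iff _).1 (hble i), ?_⟩
    simp only [b, div_eq_mul_inv]
    exact F.mul_mem (hpF i) (hF _ (hpF j))
  set N := p.natDegree + 1 with hN
  have hjN : j < N := by
    have := le_natDegree_of_ne_zero haj; omega
  have hsum : ∑ i ∈ Finset.range N, b i * x ^ i = 0 := by
    have : ∑ i ∈ Finset.range N, b i * x ^ i = (p.coeff j)⁻¹ * p.eval x := by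
      rw [eval_eq_sum_range, Finset.mul_sum]
      refine Finset.sum_congr rfl fun i _ => ?_
      simp only [b]; rw [div_eq_mul_inv]; ring
    rw [this, hpx, mul_zero]
  have hvx : v x ≤ 1 := (O.valuation_le_one_iff _).2 hx
  set e := ∑ k ∈ Finset.range (N - j), b (j + k) * x ^ k with he
  have hve : v e = 1 := by
    have h1 : N - j = (N - j - 1) + 1 := by omega
    rw [he, h1, Finset.sum_range_succ']
    simp only [add_zero, hbj, pow_zero, mul_one]
    rw [Valuation.map_add_eq_of_lt_right, map_one]
    rw [map_one]
    refine Valuation.map_sum_lt v one_ne_zero fun k _ => ?_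
    rw [map_mul, map_pow]
    refine mul_lt_one_of_lt_of_le ((hmax _ (by omega)).2 (by omega)) (pow_le_one₀ zero_le hvx)
  have he0 : e ≠ 0 := by intro h; rw [h, map_zero] at hve; exact zero_ne_one hve
  have hex : x ^ j * e = - ∑ i ∈ Finset.range j, b i * x ^ i := by
    have h1 : N = j + (N - j) := by omega
    rw [h1, Finset.sum_range_add] at hsum
    rw [eq_neg_iff_add_eq_zero, ← hsum, add_comm, he, Finset.mul_sum]
    congr 1
    refine Finset.sum_congr rfl fun k _ => ?_
    rw [pow_add]; ring
  have key : ∀ B : ValuationSubring L, (O.toSubring ⊓ F : Subring L) ≤ B.toSubring →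
      e ∈ B ∧ e * x ∈ B := by
    intro B hB
    by_cases hxB : x ∈ B
    · have : e ∈ B := by
        refine B.toSubring.sum_mem fun k _ => ?_
        exact B.toSubring.mul_mem (hB (hbA _)) (B.toSubring.pow_mem hxB _)
      exact ⟨this, B.mul_mem _ _ this hxB⟩
    · have hxi : x⁻¹ ∈ B := (B.mem_or_inv_mem x).resolve_left hxB
      have hx0 : x ≠ 0 := by rintro rfl; exact hxB B.zero_mem
      have h2 : e * x ∈ B := by
        rcases Nat.eq_zero_or_pos j with h0 | h0
        · rw [h0, pow_zero, one_mul, Finset.sum_range_zero, neg_zero] at hex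
          exact absurd hex he0
        · have : e * x = - ∑ i ∈ Finset.range j, b i * (x⁻¹) ^ (j - 1 - i) := by
            have hxj : x ^ (j - 1) ≠ 0 := pow_ne_zero _ hx0
            apply mul_left_cancel₀ hxj
            have : x ^ (j - 1) * (e * x) = x ^ j * e := by
              obtain ⟨m, rfl⟩ : ∃ m, j = m + 1 := ⟨j - 1, by omega⟩
              simp only [Nat.add_sub_cancel]; ring
            rw [this, hex, mul_neg, Finset.mul_sum]
            congr 1
            refine Finset.sum_congr rfl fun i hi => ?_
            have hi' := Finset.mem_range.1 hi
            have h3 : x ^ (j - 1) = x ^ i * x ^ (j - 1 - i) := by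
              rw [← pow_add]; congr 1; omega
            rw [h3, inv_pow]
            field_simp
          rw [this]
          refine B.neg_mem _ (B.toSubring.sum_mem fun i _ => ?_)
          exact B.toSubring.mul_mem (hB (hbA _)) (B.toSubring.pow_mem hxi _)
      refine ⟨?_, h2⟩
      have : e = (e * x) * x⁻¹ := by field_simp
      rw [this]
      exact B.mul_mem _ _ h2 hxi
  refine ⟨e, (O.valuation_le_one_iff _).1 hve.le, (O.valuation_le_one_iff _).1 ?_, he0,
    tv_integral_of_val _ _ fun B hB => (key B hB).1, tv_integral_of_val _ _ fun B hB => (key B hB).2⟩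
  rw [map_inv₀, ← hv, hve, inv_one]

open Polynomial in
theorem tv_S {K Γ : Type} [Field K] [LinearOrderedCommGroupWithZero Γ] (v : Valuation K Γ)
    (s : Multiset K) (hs : ∀ a ∈ s, v a < 1) :
    ∀ j, v ((s.map (fun a => Polynomial.X - Polynomial.C a)).prod.coeff j) ≤ 1 ∧
      (j < s.card → v ((s.map (fun a => Polynomial.X - Polynomial.C a)).prod.coeff j) < 1) := by
  induction s using Multiset.induction with
  | empty =>
    intro j
    simp only [Multiset.map_zero, Multiset.prod_zero, Polynomial.coeff_one, Multiset.card_zero]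
    refine ⟨?_, fun h => by omega⟩
    split_ifs <;> simp
  | cons a s ih =>
    have ih' := ih (fun b hb => hs b (Multiset.mem_cons_of_mem hb))
    have ha := hs a (Multiset.mem_cons_self a s)
    intro j
    simp only [Multiset.map_cons, Multiset.prod_cons, Multiset.card_cons]
    have hlt : ∀ k, v (a * (s.map (fun a => Polynomial.X - Polynomial.C a)).prod.coeff k) < 1 := by
      intro k; rw [map_mul]; exact mul_lt_one_of_lt_of_le ha (ih' k).1
    cases j with
    | zero =>
      have : ((Polynomial.X - Polynomial.C a) * (s.map (fun a => Polynomial.X - Polynomial.C a)).prod).coeff 0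
        = - (a * (s.map (fun a => Polynomial.X - Polynomial.C a)).prod.coeff 0) := by
        rw [sub_mul, Polynomial.coeff_sub, Polynomial.coeff_C_mul, mul_coeff_zero]; simp
      rw [this, Valuation.map_neg]
      exact ⟨(hlt 0).le, fun _ => hlt 0⟩
    | succ j =>
      have : ((Polynomial.X - Polynomial.C a) * (s.map (fun a => Polynomial.X - Polynomial.C a)).prod).coeff (j + 1)
        = (s.map (fun a => Polynomial.X - Polynomial.C a)).prod.coeff j - a * (s.map (fun a => Polynomial.X - Polynomial.C a)).prod.coeff (j+1) := by
        rw [sub_mul, Polynomial.coeff_sub, Polynomial.coeff_C_mul, Polynomial.coeff_X_mul]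
      rw [this]
      refine ⟨(v.map_sub _ _).trans (max_le (ih' j).1 (hlt _).le), fun h => ?_⟩
      exact (v.map_sub _ _).trans_lt (max_lt ((ih' j).2 (by omega)) (hlt _))

open Polynomial in
theorem tv_I {L : Type} [Field L] (A : Subring L) (z : L) (hz : IsIntegral A z) :
    ∃ T : Finset L, (∀ t ∈ T, t ∈ A) ∧ ∀ W : Subring L, (∀ t ∈ T, t ∈ W) →
      ∀ τ : L →+* L, (∀ a ∈ A, τ a = a) → IsIntegral W (τ z) := by
  obtain ⟨P, hP, hPz⟩ := hz
  refine ⟨(P.map A.subtype).coeffs, ?_, ?_⟩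
  · intro t ht
    obtain ⟨i, _, rfl⟩ := mem_coeffs_iff.1 ht
    rw [Polynomial.coeff_map]; exact (P.coeff i).2
  · intro W hW τ hτ
    have hlift : P.map A.subtype ∈ lifts (algebraMap W L) := by
      rw [lifts_iff_coeff_lifts]
      intro i
      by_cases h : (P.map A.subtype).coeff i = 0
      · exact ⟨0, by rw [h, map_zero]⟩
      · exact ⟨⟨_, hW _ (coeff_mem_coeffs h)⟩, rfl⟩
    obtain ⟨Q, hQ, _, hQm⟩ := lifts_and_degree_eq_and_monic hlift (hP.map _)
    refine ⟨Q, hQm, ?_⟩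
    rw [Polynomial.eval₂_eq_eval_map, hQ, Polynomial.eval_map]
    have : (A.subtype : A →+* L) = τ.comp (algebraMap A L) := by
      ext a; exact (hτ a a.2).symm
    rw [this, ← Polynomial.hom_eval₂, hPz, map_zero]
set_option linter.style.haveILetI false
open Polynomial in
theorem tv_CP {K L : Type} [Field K] [IsAlgClosed K] [Field L] [Algebra K L] (y : L)
    (hy : Transcendental K y) (O : ValuationSubring L) (a : K) (ha : algebraMap K L a ∉ O)
    (T : Finset L) (hT : ∀ t ∈ T, t ∈ O ∧ t ∈ IntermediateField.adjoin K {y}) :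
    ∃ (U : Subring L) (π : U →+* K), (∀ a : K, ∃ h : algebraMap K L a ∈ U, π ⟨_, h⟩ = a) ∧
      (∀ z : U, π z ≠ 0 → (z : L)⁻¹ ∈ U) ∧
      (∀ z : L, IsIntegral U z → z ∈ U) ∧
      ∀ t ∈ T, ∃ h : t ∈ U, algebraMap K L (π ⟨t, h⟩) ∈ O := by
  have hne : ∀ q : K[X], q ≠ 0 → Polynomial.aeval y q ≠ 0 := fun q hq h =>
    hq ((transcendental_iff.1 hy) q h)
  have hrep : ∀ t : L, ∃ g : K[X] × K[X], t ∈ T → g.2 ≠ 0 ∧ t = Polynomial.aeval y g.1 / Polynomial.aeval y g.2 := by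
    intro t
    by_cases ht : t ∈ T
    · obtain ⟨r, s, h⟩ := (IntermediateField.mem_adjoin_simple_iff K t).1 (hT t ht).2
      by_cases hs : s = 0
      · exact ⟨(0, 1), fun _ => ⟨one_ne_zero, by rw [h, hs]; simp⟩⟩
      · exact ⟨(r, s), fun _ => ⟨hs, h⟩⟩
    · exact ⟨(0, 0), fun h => absurd h ht⟩
  choose g hg using hrep
  obtain ⟨c, hc⟩ := tv_C O.valuation y (fun b hb => hy (hb ▸ isAlgebraic_algebraMap b)) a (by
      rw [← not_le, O.valuation_le_one_iff]; exact ha) (T.image g) (by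
      intro q hq
      obtain ⟨t, ht, rfl⟩ := Finset.mem_image.1 hq
      obtain ⟨h1, h2⟩ := hg t ht
      refine ⟨h1, ?_⟩
      have h3 := (O.valuation_le_one_iff t).2 (hT t ht).1
      rw [h2, map_div₀] at h3
      exact (div_le_one₀ (zero_lt_iff.2 (by simpa using hne _ h1))).1 h3)
  obtain ⟨U, π, hK, ⟨hyU, hyc⟩, hinv, hint⟩ := tv_P y hy c
  refine ⟨U, π, hK, hinv, hint, ?_⟩
  let ι : K →+* U := (algebraMap K L).codRestrict U (fun a => (hK a).1)
  have hπι : ∀ a, π (ι a) = a := fun a => (hK a).2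
  have hpoly : ∀ p : K[X], ∃ h : Polynomial.aeval y p ∈ U, π ⟨_, h⟩ = p.eval c := by
    intro p
    have h1 : ((p.eval₂ ι ⟨y, hyU⟩ : U) : L) = Polynomial.aeval y p := by
      have := Polynomial.hom_eval₂ p ι U.subtype ⟨y, hyU⟩
      rw [Polynomial.aeval_def]
      exact this
    refine ⟨h1 ▸ (p.eval₂ ι ⟨y, hyU⟩ : U).2, ?_⟩
    have h2 : (⟨Polynomial.aeval y p, h1 ▸ (p.eval₂ ι ⟨y, hyU⟩ : U).2⟩ : U) = p.eval₂ ι ⟨y, hyU⟩ :=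
      Subtype.ext h1.symm
    rw [h2, Polynomial.hom_eval₂, hyc]
    have : π.comp ι = RingHom.id K := by ext a; exact hπι a
    rw [this, Polynomial.eval₂_id]
  intro t ht
  obtain ⟨h1, h2⟩ := hg t ht
  obtain ⟨hc1, hc2⟩ := hc (g t) (Finset.mem_image_of_mem _ ht)
  obtain ⟨hp, hpe⟩ := hpoly (g t).1
  obtain ⟨hq, hqe⟩ := hpoly (g t).2
  have hqi : (Polynomial.aeval y (g t).2)⁻¹ ∈ U := hinv ⟨_, hq⟩ (by rw [hqe]; exact hc1)
  have htU : t ∈ U := by rw [h2, div_eq_mul_inv]; exact U.mul_mem hp hqi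
  refine ⟨htU, ?_⟩
  have h3 : (⟨t, htU⟩ : U) * ⟨_, hq⟩ = ⟨_, hp⟩ := by
    apply Subtype.ext
    show t * Polynomial.aeval y (g t).2 = Polynomial.aeval y (g t).1
    exact (eq_div_iff (hne _ h1)).1 h2
  have h4 := congrArg π h3
  rw [map_mul, hqe, hpe] at h4
  have h5 : π ⟨t, htU⟩ = (g t).1.eval c / (g t).2.eval c := by
    rw [← h4]; field_simp
  rw [← O.valuation_le_one_iff, h5, map_div₀, map_div₀]
  exact (div_le_one₀ (zero_lt_iff.2 (by simpa using hc1))).2 hc2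

/-- trdeg one step -/
theorem tv_T {K L : Type} [Field K] [IsAlgClosed K] [Field L] [IsAlgClosed L] [Algebra K L] (y : L)
    [Algebra.IsAlgebraic (IntermediateField.adjoin K {y}) L]
    (O : ValuationSubring L) (a : K) (ha : algebraMap K L a ∉ O)
    {σ : Type} [Fintype σ] (x : σ → L) (hx : ∀ i, x i ∈ O) :
    ∃ u : σ → K, (∀ i, algebraMap K L (u i) ∈ O) ∧
      ∀ f : MvPolynomial σ K, MvPolynomial.aeval x f = 0 → MvPolynomial.eval u f = 0 := by
  by_cases hy : Transcendental K y
  swap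
  · -- algebraic case
    have hyalg : IsAlgebraic K y := by simpa [Transcendental] using hy
    haveI : Algebra.IsAlgebraic K (IntermediateField.adjoin K {y}) :=
      IntermediateField.isAlgebraic_adjoin_simple hyalg.isIntegral
    haveI : Algebra.IsAlgebraic K L :=
      Algebra.IsAlgebraic.trans K (IntermediateField.adjoin K {y}) L
    have hb : Function.Bijective (algebraMap K L) :=
      IsAlgClosed.algebraMap_bijective_of_isIntegral
    choose u hu using fun i => hb.2 (x i)
    refine ⟨u, fun i => hu i ▸ hx i, fun f hf => ?_⟩
    apply hb.1
    rw [map_zero, ← hf]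
    have : x = fun i => algebraMap K L (u i) := by ext i; exact (hu i).symm
    have h7 := MvPolynomial.aeval_algebraMap_apply L u f
    rw [this]
    simpa [MvPolynomial.aeval_eq_eval, Function.comp_def] using h7.symm
  set F := IntermediateField.adjoin K {y} with hF
  set A : Subring L := O.toSubring ⊓ F.toSubring with hA
  have hAO : ∀ z, IsIntegral A z → z ∈ O := by
    intro z hz
    have : IsIntegral O z := by
      obtain ⟨P, hP, hPz⟩ := hz
      refine ⟨P.map (Subring.inclusion (inf_le_left : A ≤ O.toSubring)), hP.map _, ?_⟩
      rw [Polynomial.eval₂_map]; exact hPz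
    obtain ⟨w, hw⟩ := IsIntegrallyClosed.isIntegral_iff.1 this
    rw [← hw]; exact w.2
  -- choose e
  have hE : ∀ i, ∃ e : L, e ∈ O ∧ e⁻¹ ∈ O ∧ e ≠ 0 ∧ IsIntegral A e ∧ IsIntegral A (e * x i) := by
    intro i
    obtain ⟨p, hp, hpx⟩ := Algebra.IsAlgebraic.isAlgebraic (R := F) (x i)
    refine tv_E O F.toSubring (fun a ha => F.inv_mem ha) (x i) (hx i) (p.map (algebraMap F L))
      ((Polynomial.map_ne_zero_iff (algebraMap F L).injective).2 hp) ?_ ?_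
    · intro k; rw [Polynomial.coeff_map]; exact (p.coeff k).2
    · rw [Polynomial.eval_map_algebraMap]; exact hpx
  choose e heO heiO he0 heint hexint using hE
  set E := ∏ i, e i with hEdef
  have hEint : IsIntegral A E := IsIntegral.prod _ fun i _ => heint i
  have hEO : E ∈ O := O.toSubring.prod_mem fun i _ => heO i
  have hEiO : E⁻¹ ∈ O := by
    rw [hEdef, ← Finset.prod_inv_distrib]; exact O.toSubring.prod_mem fun i _ => heiO i
  have hE0 : E ≠ 0 := Finset.prod_ne_zero_iff.2 fun i _ => he0 i
  have hvE : O.valuation E = 1 := by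
    apply le_antisymm ((O.valuation_le_one_iff _).2 hEO)
    have := (O.valuation_le_one_iff _).2 hEiO
    rw [map_inv₀] at this
    exact (inv_le_one₀ (zero_lt_iff.2 (by simpa using hE0))).1 this
  have hEalg : IsIntegral F E := (Algebra.IsAlgebraic.isAlgebraic (R := F) E).isIntegral
  haveI : IsAlgClosure F L := ⟨inferInstance, inferInstance⟩
  haveI : Normal F L := IsAlgClosure.normal F L
  set μ := (minpoly F E).map (algebraMap F L) with hμ
  have hμm : μ.Monic := (minpoly.monic hEalg).map _
  have hμE : μ.eval E = 0 := by
    rw [hμ, Polynomial.eval_map_algebraMap]; exact minpoly.aeval F E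
  have hτ : ∀ r ∈ μ.roots, ∃ τ : L ≃ₐ[F] L, τ E = r := by
    intro r hr
    have h1 : IsConjRoot F E r := (isConjRoot_iff_mem_minpoly_aroots hEalg).2 hr
    exact h1.symm.exists_algEquiv
  have hτA : ∀ τ : L ≃ₐ[F] L, ∀ a ∈ A, (τ : L →+* L) a = a := by
    intro τ a ha
    exact τ.commutes ⟨a, ha.2⟩
  have hμprod : μ = (μ.roots.map (fun r => Polynomial.X - Polynomial.C r)).prod := by
    have := (IsAlgClosed.splits μ).eq_prod_roots
    rwa [hμm.leadingCoeff, Polynomial.C_1, one_mul] at this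
  have hcard : μ.roots.card = μ.natDegree := (IsAlgClosed.splits μ).natDegree_eq_card_roots.symm
  -- a lifting lemma for coefficients
  have hlift : ∀ W : Subring L, (∀ r ∈ μ.roots, r ∈ W) → ∃ s : Multiset W,
      s.map (fun w : W => (w : L)) = μ.roots ∧
      ∀ j, (((s.map (fun r => Polynomial.X - Polynomial.C r)).prod.coeff j : W) : L) = μ.coeff j := by
    intro W hW
    refine ⟨μ.roots.pmap (fun r hr => ⟨r, hr⟩) hW, ?_, ?_⟩
    · rw [Multiset.map_pmap]; simp [Multiset.pmap_eq_map]
    · intro j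
      have h1 : ((μ.roots.pmap (fun r hr => (⟨r, hr⟩ : W)) hW).map
        (fun r => Polynomial.X - Polynomial.C r)).prod.map W.subtype = μ := by
        conv_rhs => rw [hμprod]
        rw [Polynomial.map_multiset_prod, Multiset.map_map]
        simp only [Function.comp_def, Polynomial.map_sub, Polynomial.map_X, Polynomial.map_C]
        rw [Multiset.map_pmap]
        simp [Multiset.pmap_eq_map]
      conv_rhs => rw [← h1, Polynomial.coeff_map]
      rfl
  have hμO : ∀ j, μ.coeff j ∈ A := by
    intro j
    refine ⟨?_, ?_⟩
    · obtain ⟨s, _, hs⟩ := hlift O.toSubring (by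
        intro r hr
        obtain ⟨τ, rfl⟩ := hτ r hr
        obtain ⟨T, hT, h⟩ := tv_I A E hEint
        exact hAO _ (h A hT τ (hτA τ)))
      rw [← hs j]; exact Subtype.mem _
    · rw [hμ, Polynomial.coeff_map]; exact Subtype.mem _
  obtain ⟨j0, hj0, hvj0⟩ : ∃ j < μ.natDegree, O.valuation (μ.coeff j) = 1 := by
    by_contra hcon
    push Not at hcon
    have h1 := hμE
    rw [Polynomial.eval_eq_sum_range, Finset.sum_range_succ, hμm.coeff_natDegree, one_mul] at h1
    have h2 : O.valuation (∑ i ∈ Finset.range μ.natDegree, μ.coeff i * E ^ i) < 1 := by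
      refine Valuation.map_sum_lt _ one_ne_zero fun i hi => ?_
      rw [map_mul, map_pow, hvE, one_pow, mul_one]
      exact lt_of_le_of_ne ((O.valuation_le_one_iff _).2 (hμO i).1) (hcon i (Finset.mem_range.1 hi))
    rw [eq_neg_of_add_eq_zero_left h1, Valuation.map_neg, map_pow, hvE, one_pow] at h2
    exact lt_irrefl _ h2
  have hh0 : μ.coeff j0 ≠ 0 := by intro h; rw [h, map_zero] at hvj0; exact zero_ne_one hvj0
  have hhinv : (μ.coeff j0)⁻¹ ∈ A := by
    refine ⟨(O.valuation_le_one_iff _).1 (by rw [map_inv₀, hvj0, inv_one]), F.inv_mem (hμO j0).2⟩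
  choose Te hTeA hTe using fun i => tv_I A (e i) (heint i)
  choose Tx hTxA hTx using fun i => tv_I A (e i * x i) (hexint i)
  obtain ⟨TE, hTEA, hTE⟩ := tv_I A E hEint
  obtain ⟨U, π, hK, hinv, hint, hTU⟩ := tv_CP y hy O a ha
    (insert (μ.coeff j0)⁻¹ (TE ∪ (Finset.univ.biUnion Te ∪ Finset.univ.biUnion Tx))) (by
      intro t ht
      simp only [Finset.mem_insert, Finset.mem_union, Finset.mem_biUnion, Finset.mem_univ,
        true_and] at ht
      have : t ∈ A := by
        rcases ht with rfl | h | ⟨i, h⟩ | ⟨i, h⟩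
        · exact hhinv
        · exact hTEA t h
        · exact hTeA i t h
        · exact hTxA i t h
      exact this)
  let W : Subring L := ((O.comap (algebraMap K L)).toSubring.comap π).map U.subtype
  have hWmem : ∀ z, z ∈ W ↔ ∃ h : z ∈ U, algebraMap K L (π ⟨z, h⟩) ∈ O := by
    intro z
    constructor
    · rintro ⟨w, hw, rfl⟩; exact ⟨w.2, hw⟩
    · rintro ⟨h, h'⟩; exact ⟨⟨z, h⟩, h', rfl⟩
  have hWint : ∀ z, IsIntegral W z → z ∈ W := by
    intro z hz
    rw [hWmem]
    have hWU : W ≤ U := fun z hz => ((hWmem z).1 hz).1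
    obtain ⟨P, hP, hPz⟩ := hz
    have hzU : z ∈ U := by
      apply hint
      refine ⟨P.map (Subring.inclusion hWU), hP.map _, ?_⟩
      rw [Polynomial.eval₂_map]; exact hPz
    refine ⟨hzU, ?_⟩
    let ρ : W →+* O.comap (algebraMap K L) :=
      (π.comp (Subring.inclusion hWU)).codRestrict (O.comap (algebraMap K L)).toSubring (by
        intro w
        obtain ⟨h, h'⟩ := (hWmem w).1 w.2
        exact h')
    have h2 : IsIntegral (O.comap (algebraMap K L)) (π ⟨z, hzU⟩) := by
      refine ⟨P.map ρ, hP.map _, ?_⟩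
      rw [Polynomial.eval₂_map]
      have h3 : (algebraMap (O.comap (algebraMap K L)) K).comp ρ
        = π.comp (Subring.inclusion hWU) := rfl
      rw [h3, ← Polynomial.hom_eval₂]
      have h4 : Polynomial.eval₂ (Subring.inclusion hWU) ⟨z, hzU⟩ P = 0 := by
        apply Subtype.ext
        have := Polynomial.hom_eval₂ P (Subring.inclusion hWU) U.subtype ⟨z, hzU⟩
        exact this.trans hPz
      rw [h4, map_zero]
    obtain ⟨w, hw⟩ := IsIntegrallyClosed.isIntegral_iff.1 h2
    have := w.2
    rw [← hw]; exact this
  have hTW : ∀ t ∈ (insert (μ.coeff j0)⁻¹ (TE ∪ (Finset.univ.biUnion Te ∪ Finset.univ.biUnion Tx))),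
      t ∈ W := fun t ht => (hWmem t).2 (hTU t ht)
  have hEW : ∀ τ : L ≃ₐ[F] L, τ E ∈ W := fun τ =>
    hWint _ (hTE W (fun t ht => hTW t (by simp [ht])) τ (hτA τ))
  have heW : ∀ (τ : L ≃ₐ[F] L) i, τ (e i) ∈ W := fun τ i =>
    hWint _ (hTe i W (fun t ht => hTW t (by
      simp only [Finset.mem_insert, Finset.mem_union, Finset.mem_biUnion, Finset.mem_univ, true_and]
      exact Or.inr (Or.inr (Or.inl ⟨i, ht⟩)))) τ (hτA τ))
  have hxW : ∀ (τ : L ≃ₐ[F] L) i, τ (e i * x i) ∈ W := fun τ i =>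
    hWint _ (hTx i W (fun t ht => hTW t (by
      simp only [Finset.mem_insert, Finset.mem_union, Finset.mem_biUnion, Finset.mem_univ, true_and]
      exact Or.inr (Or.inr (Or.inr ⟨i, ht⟩)))) τ (hτA τ))
  have hrW : ∀ r ∈ μ.roots, r ∈ W := by
    intro r hr
    obtain ⟨τ, rfl⟩ := hτ r hr
    exact hEW τ
  set vK := O.valuation.comap (algebraMap K L) with hvK
  have hvKO : ∀ b, vK b ≤ 1 ↔ algebraMap K L b ∈ O := fun b => O.valuation_le_one_iff _
  -- find the good conjugate
  obtain ⟨τ, hτU, hτ1⟩ : ∃ (τ : L ≃ₐ[F] L), ∃ h : τ E ∈ U, vK (π ⟨τ E, h⟩) = 1 := by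
    by_contra hcon
    push Not at hcon
    obtain ⟨s, hs1, hs2⟩ := hlift U (fun r hr => ((hWmem r).1 (hrW r hr)).1)
    have hlt : ∀ b ∈ s.map π, vK b < 1 := by
      intro b hb
      obtain ⟨r, hr, rfl⟩ := Multiset.mem_map.1 hb
      have hr' : (r : L) ∈ μ.roots := by
        rw [← hs1]; exact Multiset.mem_map_of_mem _ hr
      obtain ⟨τ, hτr⟩ := hτ _ hr'
      obtain ⟨h, h'⟩ := (hWmem _).1 (hEW τ)
      have hre : r = ⟨τ E, h⟩ := Subtype.ext hτr.symm
      rw [hre]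
      exact lt_of_le_of_ne ((hvKO _).2 h') (hcon τ h)
    have h1 := (tv_S vK (s.map π) hlt j0).2 (by
      rw [Multiset.card_map]
      have := congrArg Multiset.card hs1
      rw [Multiset.card_map] at this
      omega)
    have h2 : ((s.map π).map (fun a => Polynomial.X - Polynomial.C a)).prod.coeff j0 =
      π ((s.map (fun r => Polynomial.X - Polynomial.C r)).prod.coeff j0) := by
      rw [← Polynomial.coeff_map, Polynomial.map_multiset_prod, Multiset.map_map, Multiset.map_map]
      simp [Function.comp_def]
    rw [h2] at h1
    obtain ⟨hi, hi'⟩ := hTU (μ.coeff j0)⁻¹ (by simp)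
    have h3 : (s.map (fun r => Polynomial.X - Polynomial.C r)).prod.coeff j0 * ⟨_, hi⟩ = (1 : U) := by
      apply Subtype.ext
      show (((s.map (fun r => Polynomial.X - Polynomial.C r)).prod.coeff j0 : U) : L) * _ = 1
      rw [hs2, mul_inv_cancel₀ hh0]
    have h4 := congrArg (fun z => vK (π z)) h3
    simp only [map_mul, map_one] at h4
    have h5 := mul_lt_one_of_lt_of_le h1 ((hvKO _).2 hi')
    exact absurd h4 h5.ne
  have heU : ∀ i, τ (e i) ∈ U := fun i => ((hWmem _).1 (heW τ i)).1
  have hevle : ∀ i, vK (π ⟨τ (e i), heU i⟩) ≤ 1 := fun i =>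
    (hvKO _).2 ((hWmem _).1 (heW τ i)).2
  have hprod : ∏ i, vK (π ⟨τ (e i), heU i⟩) = 1 := by
    rw [← hτ1, ← map_prod, ← map_prod]
    congr 2
    apply Subtype.ext
    rw [← Subring.subtype_apply, map_prod]
    simp [E]
  have hev : ∀ i, vK (π ⟨τ (e i), heU i⟩) = 1 := by
    intro i
    by_contra hne
    have h1 := lt_of_le_of_ne (hevle i) hne
    rw [← Finset.mul_prod_erase _ _ (Finset.mem_univ i)] at hprod
    have h2 : ∏ k ∈ Finset.univ.erase i, vK (π ⟨τ (e k), heU k⟩) ≤ 1 :=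
      Finset.prod_le_one' fun k _ => hevle k
    exact absurd hprod (mul_lt_one_of_lt_of_le h1 h2).ne
  have hpe0 : ∀ i, π ⟨τ (e i), heU i⟩ ≠ 0 := by
    intro i h
    have := hev i
    rw [h, map_zero] at this
    exact zero_ne_one this
  have hexU : ∀ i, τ (e i * x i) ∈ U := fun i => ((hWmem _).1 (hxW τ i)).1
  have hxU : ∀ i, τ (x i) ∈ U := by
    intro i
    have : τ (x i) = τ (e i * x i) * (τ (e i))⁻¹ := by
      have h0 : τ (e i) ≠ 0 := by simpa using he0 i
      rw [map_mul]; field_simp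
    rw [this]
    exact U.mul_mem (hexU i) (hinv ⟨_, heU i⟩ (hpe0 i))
  refine ⟨fun i => π ⟨τ (x i), hxU i⟩, ?_, ?_⟩
  · intro i
    rw [← hvKO]
    have h1 : (⟨τ (e i), heU i⟩ : U) * ⟨τ (x i), hxU i⟩ = ⟨τ (e i * x i), hexU i⟩ :=
      Subtype.ext (map_mul τ _ _).symm
    have h2 := congrArg π h1
    rw [map_mul] at h2
    have h3 := congrArg vK h2
    rw [map_mul, hev, one_mul] at h3
    rw [h3]
    exact (hvKO _).2 ((hWmem _).1 (hxW τ i)).2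
  · intro f hf
    let ι : K →+* U := (algebraMap K L).codRestrict U (fun a => (hK a).1)
    have hπι : π.comp ι = RingHom.id K := by ext a; exact (hK a).2
    have h1 : MvPolynomial.eval₂ ι (fun i => (⟨τ (x i), hxU i⟩ : U)) f = 0 := by
      apply Subtype.ext
      have h2 := MvPolynomial.eval₂_comp_left U.subtype ι (fun i => (⟨τ (x i), hxU i⟩ : U)) f
      refine h2.trans ?_
      have h3 := congrArg (τ : L →+* L) hf
      rw [MvPolynomial.aeval_def, MvPolynomial.eval₂_comp_left, map_zero] at h3
      have h4 : U.subtype.comp ι = (τ : L →+* L).comp (algebraMap K L) := by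
        ext b
        exact (τ.commutes (algebraMap K F b)).symm
      rw [h4]
      exact h3
    have h2 := congrArg π h1
    rw [MvPolynomial.eval₂_comp_left, hπι, map_zero] at h2
    exact h2

theorem tv_algtrans {A B L : Type} [Field A] [Field B] [Field L] [Algebra A L] [Algebra B L]
    (h : ∀ a : A, ∃ b : B, algebraMap B L b = algebraMap A L a) (z : L) (hz : IsAlgebraic A z) :
    IsAlgebraic B z := by
  obtain ⟨p, hp, hpz⟩ := hz
  have h1 : p.map (algebraMap A L) ∈ Polynomial.lifts (algebraMap B L) := by
    rw [Polynomial.lifts_iff_coeff_lifts]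
    intro k
    rw [Polynomial.coeff_map]
    obtain ⟨b, hb⟩ := h (p.coeff k)
    exact ⟨b, hb⟩
  obtain ⟨q, hq⟩ := (Polynomial.mem_lifts _).1 h1
  refine ⟨q, ?_, ?_⟩
  · rintro rfl
    rw [Polynomial.map_zero] at hq
    exact hp ((Polynomial.map_eq_zero_iff (algebraMap A L).injective).1 hq.symm)
  · rw [← Polynomial.eval_map_algebraMap, hq, Polynomial.eval_map_algebraMap, hpz]

theorem tv_M {L : Type} [Field L] [IsAlgClosed L] (O : ValuationSubring L) {σ : Type} [Fintype σ]
    (x : σ → L) (hx : ∀ i, x i ∈ O) (S : Finset L) :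
    ∀ (K : Type) [Field K] [IsAlgClosed K] [Algebra K L]
    (_ : ∀ z : L, IsAlgebraic (IntermediateField.adjoin K (S : Set L)) z)
    (a : K) (_ : algebraMap K L a ∉ O),
    ∃ u : σ → K, (∀ i, algebraMap K L (u i) ∈ O) ∧
      ∀ f : MvPolynomial σ K, MvPolynomial.aeval x f = 0 → MvPolynomial.eval u f = 0 := by
  classical
  induction S using Finset.induction_on with
  | empty =>
    intro K _ _ _ hS a ha
    haveI : Algebra.IsAlgebraic (IntermediateField.adjoin K {(0 : L)}) L := by
      refine ⟨fun z => tv_algtrans ?_ z (hS z)⟩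
      intro c
      refine ⟨⟨c, ?_⟩, rfl⟩
      exact IntermediateField.adjoin.mono K _ _ (by simp) c.2
    exact tv_T (0 : L) O a ha x hx
  | insert y S hyS ih =>
    intro K _ _ _ hS a ha
    let K1 := IntermediateField.adjoin K {y}
    let F := algebraicClosure K1 L
    haveI : IsAlgClosed F := (algebraicClosure.isAlgClosure K1 L).isAlgClosed
    haveI : IsScalarTower K F L := IsScalarTower.of_algebraMap_eq (fun _ => rfl)
    have hyK1 : y ∈ K1 := IntermediateField.mem_adjoin_simple_self K y
    let yF : F := algebraMap K1 F ⟨y, hyK1⟩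
    have h1 : ∀ z : L, IsAlgebraic (IntermediateField.adjoin F (S : Set L)) z := by
      intro z
      refine tv_algtrans ?_ z (hS z)
      intro c
      refine ⟨⟨c, ?_⟩, rfl⟩
      have h2 : IntermediateField.adjoin K ((insert y S : Finset L) : Set L) ≤
          (IntermediateField.adjoin F (S : Set L)).restrictScalars K := by
        rw [IntermediateField.adjoin_le_iff]
        intro t ht
        simp only [Finset.coe_insert, Set.mem_insert_iff] at ht
        rcases ht with rfl | ht
        · exact (IntermediateField.adjoin F (S : Set L)).algebraMap_mem yF
        · exact IntermediateField.subset_adjoin F _ ht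
      exact h2 c.2
    obtain ⟨v, hv1, hv2⟩ := ih F h1 (algebraMap K F a) ha
    have h3 : Algebra.IsAlgebraic (IntermediateField.adjoin K {yF}) F := by
      refine ⟨fun z => ?_⟩
      have hz : IsAlgebraic K1 (z : F) := Algebra.IsAlgebraic.isAlgebraic z
      refine tv_algtrans ?_ z hz
      intro c
      refine ⟨⟨algebraMap K1 F c, ?_⟩, rfl⟩
      have h4 : K1 ≤ (IntermediateField.adjoin K {yF}).map (IsScalarTower.toAlgHom K F L) := by
        rw [IntermediateField.adjoin_map]
        apply IntermediateField.adjoin.mono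
        intro t ht
        refine ⟨yF, rfl, ?_⟩
        exact ht.symm
      obtain ⟨d, hd, hdc⟩ := h4 c.2
      have : d = algebraMap K1 F c := Subtype.ext hdc
      rw [← this]; exact hd
    obtain ⟨u, hu1, hu2⟩ := tv_T yF (O.comap (algebraMap F L)) a ha v hv1
    refine ⟨u, hu1, fun f hf => ?_⟩
    apply hu2
    have h5 := hv2 (MvPolynomial.map (algebraMap K F) f) (by
      rw [MvPolynomial.aeval_map_algebraMap]; exact hf)
    rw [MvPolynomial.eval_map] at h5
    exact h5

theorem tv_clear {K : Type} [Field K] (R : ValuationSubring K) {σ : Type} (f : MvPolynomial σ K) :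
    ∃ r : R, r ≠ 0 ∧ ∃ g : MvPolynomial σ R, g.map R.subtype = MvPolynomial.C (r : K) * f := by
  classical
  obtain ⟨r, hr⟩ := IsLocalization.exist_integer_multiples_of_finset (nonZeroDivisors R)
    (f.support.image (fun m => f.coeff m))
  refine ⟨r, nonZeroDivisors.ne_zero r.2, ?_⟩
  have h : MvPolynomial.C ((r : R) : K) * f ∈ (MvPolynomial.map (σ := σ) R.subtype).range := by
    change _ ∈ Set.range (MvPolynomial.map (σ := σ) R.subtype)
    rw [MvPolynomial.mem_range_map_iff_coeffs_subset]
    intro c hc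
    rw [Finset.mem_coe, MvPolynomial.mem_coeffs_iff] at hc
    obtain ⟨m, hm, rfl⟩ := hc
    rw [MvPolynomial.coeff_C_mul]
    have h2 : f.coeff m ∈ f.support.image (fun m => f.coeff m) := by
      refine Finset.mem_image_of_mem _ ?_
      rw [MvPolynomial.mem_support_iff] at hm ⊢
      intro h0; apply hm; rw [MvPolynomial.coeff_C_mul, h0, mul_zero]
    obtain ⟨b, hb⟩ := hr _ h2
    refine ⟨b, hb.trans ?_⟩
    rw [Algebra.smul_def]; rfl
  exact h

theorem tv_frac {A : Type} [CommRing A] (P : Ideal A) [P.IsPrime] :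
    ∃ (E L : Type) (_ : Field E) (_ : Field L) (_ : IsAlgClosed L) (_ : Algebra E L)
      (φ : A →+* E), (∀ f, φ f = 0 ↔ f ∈ P) ∧ (∀ z : L, IsAlgebraic E z) ∧
      ∀ c : E, ∃ p q, c = φ p / φ q := by
  refine ⟨FractionRing (A ⧸ P), AlgebraicClosure (FractionRing (A ⧸ P)), inferInstance,
    inferInstance, inferInstance, inferInstance,
    (algebraMap (A ⧸ P) (FractionRing (A ⧸ P))).comp (Ideal.Quotient.mk P), ?_, ?_, ?_⟩
  · intro f
    rw [← Ideal.Quotient.eq_zero_iff_mem]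
    exact map_eq_zero_iff _ (IsFractionRing.injective (A ⧸ P) (FractionRing (A ⧸ P)))
  · exact fun z => Algebra.IsAlgebraic.isAlgebraic z
  · intro c
    obtain ⟨p, q, hq, rfl⟩ := IsFractionRing.div_surjective (A := A ⧸ P) c
    obtain ⟨p', rfl⟩ := Ideal.Quotient.mk_surjective p
    obtain ⟨q', rfl⟩ := Ideal.Quotient.mk_surjective q
    exact ⟨p', q', rfl⟩

theorem tv_dom {A L : Type} [CommRing A] [Field L] (Q : Ideal A) [Q.IsPrime] (φ : A →+* L)
    (hk : ∀ f, φ f = 0 → f ∈ Q) : ∃ (O : ValuationSubring L) (h : ∀ f, φ f ∈ O),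
      ∀ f, IsUnit (⟨φ f, h f⟩ : O) ↔ f ∉ Q := by
  have hunit : ∀ y : Q.primeCompl, IsUnit (φ y) := by
    intro y
    rw [isUnit_iff_ne_zero]
    exact fun hy => y.2 (hk _ hy)
  let Φ : Localization.AtPrime Q →+* L := IsLocalization.lift (M := Q.primeCompl) hunit
  have hΦ : ∀ f, Φ (algebraMap _ _ f) = φ f := fun f => IsLocalization.lift_eq _ f
  obtain ⟨O, hO, hloc⟩ := IsLocalRing.exists_factor_valuationRing (R := Localization.AtPrime Q) Φ
  have hφO : ∀ f, φ f ∈ O := fun f => hΦ f ▸ hO _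
  refine ⟨O, hφO, fun f => ?_⟩
  · have h1 := IsLocalization.AtPrime.isUnit_to_map_iff (Localization.AtPrime Q) Q f
    have h2 : (⟨φ f, hφO f⟩ : O) = Φ.codRestrict O.toSubring hO (algebraMap _ _ f) :=
      Subtype.ext (hΦ f).symm
    constructor
    · intro hu
      rw [h2] at hu
      exact h1.1 (hloc.map_nonunit _ hu)
    · intro hf
      rw [h2]
      exact (h1.2 hf).map _

theorem tv_N {K : Type} [Field K] [IsAlgClosed K] (R : ValuationSubring K) (a : K) (ha : a ∉ R)
    {n : ℕ} (I : Ideal (MvPolynomial (Fin n) K))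
    (h : ∀ f : MvPolynomial (Fin n) R, f.map R.subtype ∈ I → ∀ m : Fin n →₀ ℕ,
      ¬ ∀ b, (MvPolynomial.monomial m 1 - f).coeff b ∈ IsLocalRing.maximalIdeal R) :
    ∃ u : Fin n → K, (∀ i, u i ≠ 0 ∧ u i ∈ R ∧ (u i)⁻¹ ∈ R) ∧
      ∀ f ∈ I, MvPolynomial.eval u f = 0 := by
  classical
  let J : Ideal (MvPolynomial (Fin n) R) := I.comap (MvPolynomial.map R.subtype)
  let Jm := J ⊔ (IsLocalRing.maximalIdeal R).map MvPolynomial.C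
  let m : MvPolynomial (Fin n) R := ∏ i, MvPolynomial.X i
  have hm : ∀ k, ∃ b, m ^ k = MvPolynomial.monomial b 1 := by
    have h0 : ∃ b, m = MvPolynomial.monomial b 1 := by
      refine ⟨∑ i, Finsupp.single i 1, ?_⟩
      rw [MvPolynomial.monomial_sum_one]
      rfl
    obtain ⟨b, hb⟩ := h0
    intro k
    exact ⟨k • b, by rw [hb, MvPolynomial.monomial_pow, one_pow]⟩
  have hdisj : Disjoint (Jm : Set (MvPolynomial (Fin n) R)) (Submonoid.powers m : Set _) := by
    rw [Set.disjoint_left]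
    rintro f hf ⟨k, rfl⟩
    obtain ⟨b, hb⟩ := hm k
    obtain ⟨j, hj, e, he, hje⟩ := Submodule.mem_sup.1 hf
    refine h j hj b ?_
    rw [← MvPolynomial.mem_map_C_iff, ← hb]
    have : m ^ k - j = e := by
      rw [sub_eq_iff_eq_add, add_comm]; exact hje.symm
    rw [this]; exact he
  obtain ⟨Q, hQp, hJQ, hQd⟩ := Ideal.exists_le_prime_disjoint Jm _ hdisj
  have hXQ : ∀ i, MvPolynomial.X i ∉ Q := by
    intro i hi
    refine Set.disjoint_left.1 hQd (?_ : m ∈ Q) ⟨1, pow_one _⟩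
    exact Ideal.mem_of_dvd Q (Finset.dvd_prod_of_mem _ (Finset.mem_univ i)) hi
  obtain ⟨P, hPmin, hPQ⟩ := Ideal.exists_minimalPrimes_le (le_sup_left.trans hJQ : J ≤ Q)
  haveI hPp : P.IsPrime := hPmin.1.1
  have hJP : J ≤ P := hPmin.1.2
  have hPR : ∀ c : R, MvPolynomial.C c ∈ P → c = 0 := by
    intro c hc
    by_contra hc0
    obtain ⟨y, hy, hcy⟩ := Ideal.exists_mul_mem_of_mem_minimalPrimes hPmin hc
    apply hy
    have h1 : MvPolynomial.map R.subtype (MvPolynomial.C c * y) ∈ I := hcy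
    rw [map_mul, MvPolynomial.map_C] at h1
    have h2 := I.mul_mem_left (MvPolynomial.C (R.subtype c)⁻¹) h1
    rw [← mul_assoc, ← MvPolynomial.C_mul, inv_mul_cancel₀ (by simpa using hc0),
      MvPolynomial.C_1, one_mul] at h2
    exact h2
  obtain ⟨E, L, _, _, _, _, φ0, hφ0, hEL, hEq⟩ := tv_frac P
  let φ : MvPolynomial (Fin n) R →+* L := (algebraMap E L).comp φ0
  have hφ : ∀ f, φ f = 0 ↔ f ∈ P := by
    intro f
    rw [← hφ0]
    exact map_eq_zero_iff _ (algebraMap E L).injective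
  obtain ⟨O, hφO, hQunit⟩ := tv_dom Q φ (fun f hf => hPQ ((hφ f).1 hf))
  have hinjR : Function.Injective (φ.comp MvPolynomial.C) := by
    rw [injective_iff_map_eq_zero]
    intro c hc
    exact hPR c ((hφ _).1 hc)
  let ψ : K →+* L := IsFractionRing.lift (A := R) (K := K) hinjR
  have hψ : ∀ r : R, ψ (r : K) = φ (MvPolynomial.C r) := fun r =>
    IsFractionRing.lift_algebraMap hinjR r
  letI : Algebra K L := ψ.toAlgebra
  have hψa : ∀ c, algebraMap K L c = ψ c := fun _ => rfl
  have hKO : ∀ c : K, ψ c ∈ O → c ∈ R := by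
    intro c hc
    by_contra hcR
    have hc0 : c ≠ 0 := by rintro rfl; exact hcR R.zero_mem
    have hci : c⁻¹ ∈ R := (R.mem_or_inv_mem c).resolve_left hcR
    have hcm : (⟨c⁻¹, hci⟩ : R) ∈ IsLocalRing.maximalIdeal R := by
      rw [IsLocalRing.mem_maximalIdeal, mem_nonunits_iff]
      intro hu
      obtain ⟨d, hd⟩ := hu.exists_right_inv
      have hd' : c⁻¹ * (d : K) = 1 := congrArg Subtype.val hd
      have : (d : K) = c := by field_simp at hd'; exact hd'
      exact hcR (this ▸ d.2)
    have h1 : MvPolynomial.C (⟨c⁻¹, hci⟩ : R) ∈ Q :=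
      hJQ (Ideal.mem_sup_right (Ideal.mem_map_of_mem _ hcm))
    refine (hQunit _).not.2 (not_not.2 h1) ?_
    refine IsUnit.of_mul_eq_one (⟨ψ c, hc⟩ : O) ?_
    apply Subtype.ext
    change φ (MvPolynomial.C (⟨c⁻¹, hci⟩ : R)) * ψ c = 1
    rw [← hψ, ← map_mul]
    change ψ (c⁻¹ * c) = 1
    rw [inv_mul_cancel₀ hc0, map_one]
  let x : Fin n → L := fun i => φ (MvPolynomial.X i)
  have hx0 : ∀ i, x i ≠ 0 := fun i => by
    rw [Ne, hφ]; exact fun h => hXQ i (hPQ h)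
  have hxi : ∀ i, (x i)⁻¹ ∈ O := by
    intro i
    obtain ⟨d, hd⟩ := ((hQunit _).2 (hXQ i)).exists_right_inv
    have hd' : x i * (d : L) = 1 := congrArg Subtype.val hd
    rw [inv_eq_of_mul_eq_one_right hd']
    exact d.2
  have hφx : ∀ f, φ f = MvPolynomial.aeval x (MvPolynomial.map R.subtype f) := by
    intro f
    have : φ = (MvPolynomial.aeval x : MvPolynomial (Fin n) K →ₐ[K] L).toRingHom.comp
        (MvPolynomial.map R.subtype) := by
      apply MvPolynomial.ringHom_ext
      · intro r
        simp only [RingHom.comp_apply, MvPolynomial.map_C]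
        exact ((MvPolynomial.aeval_C x _).trans (hψ r)).symm
      · intro i
        simp only [RingHom.comp_apply, MvPolynomial.map_X]
        exact (MvPolynomial.aeval_X x i).symm
    exact congrArg (fun g : MvPolynomial (Fin n) R →+* L => g f) this
  have hxI : ∀ f ∈ I, MvPolynomial.aeval x f = 0 := by
    intro f hf
    obtain ⟨r, hr, g, hg⟩ := tv_clear R f
    have hgJ : g ∈ J := by
      change MvPolynomial.map R.subtype g ∈ I
      rw [hg]; exact I.mul_mem_left _ hf
    have h1 := (hφ g).2 (hJP hgJ)
    rw [hφx, hg, map_mul, MvPolynomial.aeval_C] at h1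
    refine (mul_eq_zero.1 h1).resolve_left ?_
    rw [hψa]
    simpa using hr
  let S : Finset L := Finset.univ.image x
  have hS : ∀ z : L, IsAlgebraic (IntermediateField.adjoin K (S : Set L)) z := by
    intro z
    refine tv_algtrans (A := E) ?_ z (hEL z)
    have hmem : ∀ f, φ f ∈ IntermediateField.adjoin K (S : Set L) := by
      intro f
      rw [hφx]
      refine IntermediateField.algebra_adjoin_le_adjoin K _ ?_
      rw [show ((S : Finset L) : Set L) = Set.range x by simp [S],
        Algebra.adjoin_range_eq_range_aeval]
      exact ⟨_, rfl⟩
    intro c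
    obtain ⟨p', q', rfl⟩ := hEq c
    refine ⟨⟨φ p' / φ q', IntermediateField.div_mem _ (hmem _) (hmem _)⟩, ?_⟩
    rw [map_div₀]
    rfl
  obtain ⟨u, hu1, hu2⟩ := tv_M O (Sum.elim x (fun i => (x i)⁻¹))
    (by rintro (i | i); exacts [hφO _, hxi i]) S K hS a (fun h => ha (hKO _ h))
  have hrel : ∀ i, u (Sum.inl i) * u (Sum.inr i) = 1 := by
    intro i
    have := hu2 (MvPolynomial.X (Sum.inl i) * MvPolynomial.X (Sum.inr i) - 1) (by
      simp [hx0 i])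
    simpa [sub_eq_zero] using this
  refine ⟨fun i => u (Sum.inl i), fun i => ⟨left_ne_zero_of_mul_eq_one (hrel i),
    hKO _ (hu1 _), ?_⟩, ?_⟩
  · rw [inv_eq_of_mul_eq_one_right (hrel i)]; exact hKO _ (hu1 _)
  · intro f hf
    have := hu2 (MvPolynomial.rename Sum.inl f) (by
      rw [MvPolynomial.aeval_rename]; exact hxI f hf)
    rw [MvPolynomial.eval_rename] at this
    exact this
theorem tv_strict {K : Type} [Field K] (V : ValData K) {n : ℕ} (f : MvPolynomial (Fin n) K)
    (hf : f ≠ 0) (w : Fin n → ℝ) (hw : w ∉ V.tropHyp f) :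
    ∃ a ∈ f.support, ∀ b ∈ f.support, b ≠ a → V.termWeight w f a < V.termWeight w f b := by
  obtain ⟨a, ha, hmin⟩ := f.support.exists_min_image (V.termWeight w f)
    (MvPolynomial.support_nonempty.2 hf)
  refine ⟨a, ha, fun b hb hba => lt_of_le_of_ne (hmin b hb) fun h => hw ?_⟩
  exact ⟨a, ha, b, hb, hba.symm, h, hmin⟩

theorem tv_closed {K : Type} [Field K] (V : ValData K) {n : ℕ} (f : MvPolynomial (Fin n) K) :
    IsClosed (V.tropHyp f) := by
  have hc : ∀ a, Continuous (fun w => V.termWeight w f a) := by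
    intro a
    unfold ValData.termWeight Finsupp.sum
    fun_prop
  have : V.tropHyp f = ⋃ a ∈ f.support, ⋃ b ∈ f.support, {w | a ≠ b ∧
      V.termWeight w f a = V.termWeight w f b ∧
      ∀ c ∈ f.support, V.termWeight w f a ≤ V.termWeight w f c} := by
    ext w
    simp only [ValData.tropHyp, Set.mem_ofPred_eq, Set.mem_iUnion, exists_prop]
  rw [this]
  refine Set.Finite.isClosed_biUnion f.support.finite_toSet fun a _ => ?_
  refine Set.Finite.isClosed_biUnion f.support.finite_toSet fun b _ => ?_
  refine isClosed_const.and ((isClosed_eq (hc a) (hc b)).and ?_)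
  simp only [Set.ofPred_forall]
  exact isClosed_iInter fun c => isClosed_iInter fun _ => isClosed_le (hc a) (hc c)

noncomputable def tvSc {K : Type} [Field K] {n : ℕ} (s : Fin n → K) :
    MvPolynomial (Fin n) K →ₐ[K] MvPolynomial (Fin n) K :=
  bind₁ fun i => C (s i) * (X i : MvPolynomial (Fin n) K)

theorem tv_sc_coeff {K : Type} [Field K] {n : ℕ} (s : Fin n → K)
    (f : MvPolynomial (Fin n) K) (a : Fin n →₀ ℕ) :
    (tvSc s f).coeff a = f.coeff a * a.prod fun i e => s i ^ e := by
  induction f using MvPolynomial.induction_on' with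
  | monomial b c =>
    have h1 : tvSc s (monomial b c) = monomial b (c * b.prod fun i e => s i ^ e) := by
      rw [tvSc, bind₁_monomial]
      simp only [mul_pow, Finsupp.prod, Finset.prod_mul_distrib]
      rw [monomial_eq, C_mul, map_prod, mul_assoc]
      simp only [C_pow, Finsupp.prod]
    rw [h1, coeff_monomial, coeff_monomial]
    split_ifs with h
    · rw [h]
    · rw [zero_mul]
  | add p q hp hq => rw [map_add, coeff_add, hp, hq, coeff_add, add_mul]

theorem tv_sc_inv {K : Type} [Field K] {n : ℕ} (s : Fin n → K) (hs : ∀ i, s i ≠ 0)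
    (f : MvPolynomial (Fin n) K) : tvSc (fun i => (s i)⁻¹) (tvSc s f) = f := by
  ext a
  rw [tv_sc_coeff, tv_sc_coeff, mul_assoc, ← Finsupp.prod_mul]
  have : (a.prod fun i e => s i ^ e * (s i)⁻¹ ^ e) = 1 := by
    apply Finset.prod_eq_one
    intro i _
    change s i ^ a i * (s i)⁻¹ ^ a i = 1
    rw [← mul_pow, mul_inv_cancel₀ (hs i), one_pow]
  rw [this, mul_one]

theorem tv_deg_prod {K : Type} [Field K] (V : ValData K) {ι : Type} (t : Finset ι) (g : ι → K)
    (hg : ∀ i ∈ t, g i ≠ 0) : V.deg (∏ i ∈ t, g i) = ∑ i ∈ t, V.deg (g i) := by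
  induction t using Finset.induction_on with
  | empty => simpa using V.deg_one
  | insert a t ha ih =>
    rw [Finset.prod_insert ha, Finset.sum_insert ha, V.deg_mul, ih]
    · exact fun i hi => hg i (Finset.mem_insert_of_mem hi)
    · exact hg a (Finset.mem_insert_self _ _)
    · exact Finset.prod_ne_zero_iff.2 fun i hi => hg i (Finset.mem_insert_of_mem hi)

theorem tv_deg_pow {K : Type} [Field K] (V : ValData K) (c : K) (hc : c ≠ 0) (e : ℕ) :
    V.deg (c ^ e) = e * V.deg c := by
  induction e with
  | zero => simpa using V.deg_one
  | succ k ih =>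
    rw [pow_succ, V.deg_mul _ _ (pow_ne_zero _ hc) hc, ih]; push_cast; ring

theorem tv_deg_inv {K : Type} [Field K] (V : ValData K) (c : K) (hc : c ≠ 0) :
    V.deg c⁻¹ = - V.deg c := by
  have := V.deg_mul c c⁻¹ hc (inv_ne_zero hc)
  rw [mul_inv_cancel₀ hc, V.deg_one] at this
  linarith

theorem tv_sc_deg {K : Type} [Field K] (V : ValData K) {n : ℕ} (s : Fin n → K)
    (w : Fin n → ℝ) (hs : ∀ i, s i ≠ 0 ∧ V.deg (s i) = w i)
    (f : MvPolynomial (Fin n) K) (a : Fin n →₀ ℕ) (ha : f.coeff a ≠ 0) :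
    (tvSc s f).coeff a ≠ 0 ∧ V.deg ((tvSc s f).coeff a) = V.termWeight w f a := by
  have h1 : (a.prod fun i e => s i ^ e) ≠ 0 :=
    Finset.prod_ne_zero_iff.2 fun i _ => pow_ne_zero _ (hs i).1
  rw [tv_sc_coeff]
  refine ⟨mul_ne_zero ha h1, ?_⟩
  rw [V.deg_mul _ _ ha h1, ValData.termWeight]
  congr 1
  rw [Finsupp.prod, tv_deg_prod V _ _ fun i _ => pow_ne_zero _ (hs i).1, Finsupp.sum]
  refine Finset.sum_congr rfl fun i _ => ?_
  rw [tv_deg_pow V _ (hs i).1, (hs i).2]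

/-- no element of the scaled ideal reduces to a monomial -/
theorem tv_K1 {K : Type} [Field K] (V : ValData K) {n : ℕ} (s : Fin n → K)
    (w : Fin n → ℝ) (hs : ∀ i, s i ≠ 0 ∧ V.deg (s i) = w i)
    (I : Ideal (MvPolynomial (Fin n) K)) (hw : ∀ f ∈ I, f ≠ 0 → w ∈ V.tropHyp f)
    (g : MvPolynomial (Fin n) K) (hg : tvSc (fun i => (s i)⁻¹) g ∈ I) (m : Fin n →₀ ℕ)
    (hm : g.coeff m ≠ 0) (hm0 : V.deg (g.coeff m) = 0)
    (hb : ∀ b, b ≠ m → g.coeff b ≠ 0 → 0 < V.deg (g.coeff b)) : False := by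
  set f := tvSc (fun i => (s i)⁻¹) g with hf
  have hgf : tvSc s f = g := by
    have := tv_sc_inv (fun i => (s i)⁻¹) (fun i => inv_ne_zero (hs i).1) g
    simpa using this
  have hfc : ∀ b, f.coeff b ≠ 0 → g.coeff b ≠ 0 ∧ V.deg (g.coeff b) = V.termWeight w f b := by
    intro b hb
    have := tv_sc_deg V s w hs f b hb
    rwa [hgf] at this
  have hfm : f.coeff m ≠ 0 := by
    intro h
    apply hm
    rw [← hgf, tv_sc_coeff, h, zero_mul]
  obtain ⟨a, ha, b, hb', hab, heq, hmin⟩ := hw f hg (by rintro h; rw [h] at hfm; simp at hfm)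
  have hle := hmin m (mem_support_iff.2 hfm)
  rw [← (hfc m hfm).2, hm0] at hle
  have key : ∀ c ∈ f.support, V.termWeight w f c ≤ 0 → c = m := by
    intro c hc hc0
    by_contra hcm
    obtain ⟨h1, h2⟩ := hfc c (mem_support_iff.1 hc)
    have := hb c hcm h1
    linarith
  exact hab ((key a ha hle).trans (key b hb' (heq ▸ hle)).symm)

theorem tv_sum_deg {K : Type} [Field K] (V : ValData K) {ι : Type} (t : Finset ι) (g : ι → K)
    (r : ℝ) (hg : ∀ i ∈ t, g i ≠ 0 → r < V.deg (g i)) :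
    (∑ i ∈ t, g i) ≠ 0 → r < V.deg (∑ i ∈ t, g i) := by
  induction t using Finset.induction_on with
  | empty => simp
  | insert a t ha ih =>
    rw [Finset.sum_insert ha]
    have ih' := ih fun i hi => hg i (Finset.mem_insert_of_mem hi)
    have hga := hg a (Finset.mem_insert_self _ _)
    intro hne
    by_cases h0 : g a = 0
    · rw [h0, zero_add] at hne ⊢; exact ih' hne
    by_cases h1 : ∑ i ∈ t, g i = 0
    · rw [h1, add_zero]; exact hga h0
    exact (lt_min (hga h0) (ih' h1)).trans_le (V.deg_add _ _ h0 h1 hne)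

theorem tv_sc_eval {K : Type} [Field K] {n : ℕ} (s u : Fin n → K)
    (f : MvPolynomial (Fin n) K) :
    eval u (tvSc s f) = eval (fun i => s i * u i) f := by
  have h := eval₂Hom_bind₁ (RingHom.id K) u (fun i => C (s i) * (X i : MvPolynomial (Fin n) K)) f
  simpa [tvSc] using h

/-- (a) in (b) -/
theorem tv_ab {K : Type} [Field K] (V : ValData K) {n : ℕ} (f : MvPolynomial (Fin n) K)
    (hf : f ≠ 0) (u : Fin n → K) (hu : ∀ i, u i ≠ 0) (h0 : eval u f = 0) :
    (fun i => V.deg (u i)) ∈ V.tropHyp f := by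
  by_contra hw
  obtain ⟨a, ha, hlt⟩ := tv_strict V f hf _ hw
  have hs := tv_sc_deg V u (fun i => V.deg (u i)) (fun i => ⟨hu i, rfl⟩) f
  have h1 : ∑ b ∈ f.support, (tvSc u f).coeff b = 0 := by
    rw [← h0, eval_eq]
    refine Finset.sum_congr rfl fun b _ => ?_
    rw [tv_sc_coeff]; rfl
  rw [← Finset.add_sum_erase _ _ ha] at h1
  have ha1 := hs a (mem_support_iff.1 ha)
  have h2 := tv_sum_deg V (f.support.erase a) (fun b => (tvSc u f).coeff b)
    (V.termWeight (fun i => V.deg (u i)) f a) (by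
      intro b hb _
      have hb' := Finset.mem_of_mem_erase hb
      rw [(hs b (mem_support_iff.1 hb')).2]
      exact hlt b hb' (Finset.ne_of_mem_erase hb))
  rw [← eq_neg_iff_add_eq_zero] at h1
  have h3 : ∑ b ∈ f.support.erase a, (tvSc u f).coeff b = - (tvSc u f).coeff a := by
    rw [h1, neg_neg]
  rw [h3, V.deg_neg _ ha1.1, ha1.2] at h2
  exact lt_irrefl _ (h2 (neg_ne_zero.2 ha1.1))

def tvR {K : Type} [Field K] (V : ValData K) : ValuationSubring K :=
  { V.RK with
    mem_or_inv_mem' := by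
      intro x
      by_cases hx : x = 0
      · left; intro h; exact absurd hx h
      rcases le_total 0 (V.deg x) with h | h
      · left; exact fun _ => h
      · right; intro _; rw [tv_deg_inv V x hx]; linarith }

theorem tv_mem_R {K : Type} [Field K] (V : ValData K) (c : K) :
    c ∈ tvR V ↔ (c ≠ 0 → 0 ≤ V.deg c) := Iff.rfl

theorem tv_max {K : Type} [Field K] (V : ValData K) (c : tvR V) :
    c ∈ IsLocalRing.maximalIdeal (tvR V) ↔ ((c : K) ≠ 0 → 0 < V.deg (c : K)) := by
  rw [IsLocalRing.mem_maximalIdeal, mem_nonunits_iff]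
  constructor
  · intro h h0
    by_contra hn
    apply h
    have hci : (c : K)⁻¹ ∈ tvR V := by
      intro _; rw [tv_deg_inv V _ h0]; linarith
    exact IsUnit.of_mul_eq_one ⟨_, hci⟩ (Subtype.ext (mul_inv_cancel₀ h0))
  · intro h hu
    obtain ⟨d, hd⟩ := hu.exists_right_inv
    have hd' : (c : K) * (d : K) = 1 := congrArg Subtype.val hd
    have hc0 : (c : K) ≠ 0 := left_ne_zero_of_mul_eq_one hd'
    have hd0 : (d : K) ≠ 0 := right_ne_zero_of_mul_eq_one hd'
    have h1 := V.deg_mul _ _ hc0 hd0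
    rw [hd', V.deg_one] at h1
    have := h hc0
    have := d.2 hd0
    linarith

/-- (b) in (a) -/
theorem tv_ba {K : Type} [Field K] [IsAlgClosed K] (V : ValData K) {n : ℕ}
    (I : Ideal (MvPolynomial (Fin n) K)) (w : Fin n → ℝ)
    (hw : ∀ f ∈ I, f ≠ 0 → w ∈ V.tropHyp f) :
    ∃ u : Fin n → K, (∀ i, u i ≠ 0) ∧ (∀ f ∈ I, eval u f = 0) ∧ w = fun i => V.deg (u i) := by
  choose s hs using fun i => V.surj (w i)
  obtain ⟨a, ha0, ha⟩ := V.surj (-1)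
  have haR : a ∉ tvR V := by
    intro h; have := h ha0; rw [ha] at this; norm_num at this
  obtain ⟨u, hu, hI⟩ := tv_N (tvR V) a haR
    (I.comap (tvSc (fun i => (s i)⁻¹) : MvPolynomial (Fin n) K →ₐ[K] _)) (by
      intro f hf m hm
      have hfm : f.coeff m ∉ IsLocalRing.maximalIdeal (tvR V) := by
        intro h
        have h1 := hm m
        rw [coeff_sub, coeff_monomial, if_pos rfl] at h1
        have h2 := Ideal.add_mem _ h1 h
        rw [sub_add_cancel] at h2
        exact (Ideal.ne_top_iff_one _).1 (IsLocalRing.maximalIdeal.isMaximal _).ne_top h2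
      rw [tv_max] at hfm
      push Not at hfm
      have hfR := (tv_mem_R V _).1 (f.coeff m).2 hfm.1
      have hcm : ∀ b, coeff b (MvPolynomial.map (tvR V).subtype f) = ((f.coeff b : tvR V) : K) :=
        fun b => coeff_map _ _ _
      have hfI : tvSc (fun i => (s i)⁻¹) (MvPolynomial.map (tvR V).subtype f) ∈ I :=
        Ideal.mem_comap.1 hf
      refine tv_K1 V s w hs I hw _ hfI m ?_ ?_ ?_
      · rw [hcm]; exact hfm.1
      · rw [hcm]; exact le_antisymm hfm.2 hfR
      · intro b hb
        have h1 := hm b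
        rw [coeff_sub, coeff_monomial, if_neg hb.symm, zero_sub, Ideal.neg_mem_iff, tv_max] at h1
        rw [hcm]; exact h1)
  refine ⟨fun i => s i * u i, fun i => mul_ne_zero (hs i).1 (hu i).1, fun f hf => ?_, ?_⟩
  · rw [← tv_sc_eval]
    apply hI
    rw [Ideal.mem_comap]
    rw [tv_sc_inv s (fun i => (hs i).1)]; exact hf
  · ext i
    obtain ⟨h0, h1, h2⟩ := hu i
    have h3 := (tv_mem_R V _).1 h1 h0
    have h4 := (tv_mem_R V _).1 h2 (inv_ne_zero h0)
    rw [tv_deg_inv V _ h0] at h4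
    rw [V.deg_mul _ _ (hs i).1 h0, (hs i).2]; linarith

theorem tv_reduce_coeff {K : Type} [Field K] (V : ValData K) {n : ℕ}
    (f : MvPolynomial (Fin n) K) (a : Fin n →₀ ℕ) :
    (V.reduce f).coeff a = V.res (f.coeff a) := by
  rw [ValData.reduce, coeff_sum]
  simp only [coeff_monomial]
  rw [Finset.sum_ite_eq']
  split_ifs with h
  · rfl
  · rw [notMem_support_iff.1 h, ValData.res, dif_pos V.RK.zero_mem]
    exact (map_zero (Ideal.Quotient.mk V.MK)).symm

theorem tv_reduce_map {K : Type} [Field K] (V : ValData K) {n : ℕ}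
    (G : MvPolynomial (Fin n) V.RK) :
    V.reduce (G.map V.RK.subtype) = G.map (Ideal.Quotient.mk V.MK) := by
  ext a
  rw [tv_reduce_coeff, coeff_map, coeff_map, ValData.res]
  exact dif_pos (G.coeff a).2

theorem tv_res_zero {K : Type} [Field K] (V : ValData K) (c : K) (hc : c ∈ V.RK) :
    V.res c = 0 ↔ (c ≠ 0 → 0 < V.deg c) := by
  rw [ValData.res, dif_pos hc, Ideal.Quotient.eq_zero_iff_mem]
  rfl

/-- (c) in (b) -/
theorem tv_cb {K : Type} [Field K] (V : ValData K) {n : ℕ}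
    (I : Ideal (MvPolynomial (Fin n) K)) (w : Fin n → ℝ)
    (h : ∀ s : Fin n → K, (∀ i, s i ≠ 0 ∧ V.deg (s i) = w i) →
          ∀ g ∈ V.inwIdeal w s I, ¬ IsMonomial g) (f : MvPolynomial (Fin n) K) (hfI : f ∈ I)
    (hf : f ≠ 0) : w ∈ V.tropHyp f := by
  by_contra hw
  obtain ⟨a, ha, hlt⟩ := tv_strict V f hf _ hw
  choose s hs using fun i => V.surj (w i)
  obtain ⟨t, ht0, ht⟩ := V.surj (V.termWeight w f a)
  have hle : ∀ b ∈ f.support, V.deg t ≤ V.termWeight w f b := by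
    intro b hb
    by_cases hba : b = a
    · rw [hba, ht]
    · rw [ht]; exact (hlt b hb hba).le
  refine h s hs _ (Ideal.subset_span ⟨f, hfI, hf, t, ht0, hle, ⟨a, ha, ht⟩, rfl⟩) ?_
  change IsMonomial (V.reduce (C t⁻¹ * tvSc s f))
  have hdeg : ∀ b ∈ f.support, (C t⁻¹ * tvSc s f).coeff b ≠ 0 ∧
      V.deg ((C t⁻¹ * tvSc s f).coeff b) = V.termWeight w f b - V.termWeight w f a := by
    intro b hb
    obtain ⟨h1, h2⟩ := tv_sc_deg V s w hs f b (mem_support_iff.1 hb)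
    rw [coeff_C_mul]
    refine ⟨mul_ne_zero (inv_ne_zero ht0) h1, ?_⟩
    rw [V.deg_mul _ _ (inv_ne_zero ht0) h1, h2, tv_deg_inv V _ ht0, ht]; ring
  refine ⟨a, V.res ((C t⁻¹ * tvSc s f).coeff a), ?_, ?_⟩
  · obtain ⟨h1, h2⟩ := hdeg a ha
    rw [sub_self] at h2
    rw [Ne, tv_res_zero V _ (fun _ => h2.ge)]
    intro h3
    exact (h3 h1).ne' h2
  · ext b
    rw [tv_reduce_coeff, coeff_monomial]
    split_ifs with hab
    · rw [hab]
    · by_cases hb : b ∈ f.support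
      · obtain ⟨h1, h2⟩ := hdeg b hb
        have h3 := hlt b hb (Ne.symm hab)
        have h4 : 0 < V.deg ((C t⁻¹ * tvSc s f).coeff b) := by rw [h2]; linarith
        exact (tv_res_zero V _ (fun _ => h4.le)).2 fun _ => h4
      · rw [coeff_C_mul, tv_sc_coeff, notMem_support_iff.1 hb, zero_mul, mul_zero]
        exact (tv_res_zero V _ V.RK.zero_mem).2 fun h => absurd rfl h

/-- (b) in (c) -/
theorem tv_bc {K : Type} [Field K] (V : ValData K) {n : ℕ}
    (I : Ideal (MvPolynomial (Fin n) K)) (w : Fin n → ℝ)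
    (hw : ∀ f ∈ I, f ≠ 0 → w ∈ V.tropHyp f)
    (s : Fin n → K) (hs : ∀ i, s i ≠ 0 ∧ V.deg (s i) = w i)
    (g : MvPolynomial (Fin n) V.kk) (hg : g ∈ V.inwIdeal w s I) : ¬ IsMonomial g := by
  rintro ⟨m, c, hc, hgm⟩
  let J : Ideal (MvPolynomial (Fin n) V.RK) :=
    (I.comap (tvSc (fun i => (s i)⁻¹) : MvPolynomial (Fin n) K →ₐ[K] _)).comap
      (MvPolynomial.map V.RK.subtype)
  have hsurj : Function.Surjective (MvPolynomial.map (σ := Fin n) (Ideal.Quotient.mk V.MK)) :=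
    MvPolynomial.map_surjective _ Ideal.Quotient.mk_surjective
  have hle : V.inwIdeal w s I ≤ J.map (MvPolynomial.map (Ideal.Quotient.mk V.MK)) := by
    unfold ValData.inwIdeal
    rw [Ideal.span_le]
    rintro _ ⟨f, hf, hf0, t, ht, hmin, _, rfl⟩
    change V.reduce (C t⁻¹ * tvSc s f) ∈ _
    have h1 : C t⁻¹ * tvSc s f ∈ Set.range (MvPolynomial.map (σ := Fin n) V.RK.subtype) := by
      rw [MvPolynomial.mem_range_map_iff_coeffs_subset]
      intro d hd
      rw [Finset.mem_coe, MvPolynomial.mem_coeffs_iff] at hd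
      obtain ⟨b, hb, rfl⟩ := hd
      suffices h5 : coeff b (C t⁻¹ * tvSc s f) ∈ V.RK from ⟨⟨_, h5⟩, rfl⟩
      intro h0
      have hb0 : f.coeff b ≠ 0 := by
        intro h2; apply h0; rw [coeff_C_mul, tv_sc_coeff, h2, zero_mul, mul_zero]
      obtain ⟨h2, h3⟩ := tv_sc_deg V s w hs f b hb0
      rw [coeff_C_mul, V.deg_mul _ _ (inv_ne_zero ht) h2, h3, tv_deg_inv V _ ht]
      have := hmin b (mem_support_iff.2 hb0)
      linarith
    obtain ⟨G, hG⟩ := h1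
    rw [← hG, tv_reduce_map]
    refine Ideal.mem_map_of_mem _ ?_
    change tvSc _ (MvPolynomial.map V.RK.subtype G) ∈ I
    rw [hG, map_mul, tv_sc_inv s (fun i => (hs i).1)]
    exact I.mul_mem_left _ hf
  obtain ⟨G, hG, hGg⟩ := (Ideal.mem_map_iff_of_surjective _ hsurj).1 (hle hg)
  have hcoef : ∀ b, Ideal.Quotient.mk V.MK (G.coeff b) = if m = b then c else 0 := by
    intro b
    rw [← coeff_map, hGg, hgm, coeff_monomial]
  have hm : ¬ (((G.coeff m : V.RK) : K) ≠ 0 → 0 < V.deg ((G.coeff m : V.RK) : K)) := by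
    intro h
    have h1 : Ideal.Quotient.mk V.MK (G.coeff m) = 0 := Ideal.Quotient.eq_zero_iff_mem.2 h
    rw [hcoef, if_pos rfl] at h1
    exact hc h1
  push Not at hm
  refine tv_K1 V s w hs I hw (MvPolynomial.map V.RK.subtype G) hG m ?_ ?_ ?_
  · rw [coeff_map]; exact hm.1
  · rw [coeff_map]; exact le_antisymm hm.2 ((G.coeff m).2 hm.1)
  · intro b hb
    rw [coeff_map]
    have h1 := hcoef b
    rw [if_neg hb.symm, Ideal.Quotient.eq_zero_iff_mem] at h1
    exact h1

/-- for an ideal `I` in the polynomial ring over an algebraically closed field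
`K` with a surjective real valuation, the following three subsets of `ℝⁿ` coincide:
(a) the closure of the coordinatewise-degree image of the variety `V(I) ⊆ (Kˣ)ⁿ`;
(b) the intersection of the tropical hypersurfaces `T(trop f)` for all `0 ≠ f ∈ I`;
(c) the set of `w` such that the initial ideal `in_w(I)` contains no monomial. -/
theorem tropical_variety_three_characterizations {K : Type} [Field K] [IsAlgClosed K]
    (V : ValData K) (n : ℕ) (I : Ideal (MvPolynomial (Fin n) K)) :
    closure { p : Fin n → ℝ | ∃ u : Fin n → K, (∀ i, u i ≠ 0) ∧
        (∀ f ∈ I, eval u f = 0) ∧ p = fun i => V.deg (u i) }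
      = { w | ∀ f ∈ I, f ≠ 0 → w ∈ V.tropHyp f }
    ∧ { w | ∀ f ∈ I, f ≠ 0 → w ∈ V.tropHyp f }
      = { w | ∀ s : Fin n → K, (∀ i, s i ≠ 0 ∧ V.deg (s i) = w i) →
          ∀ g ∈ V.inwIdeal w s I, ¬ IsMonomial g } := by

  refine ⟨Set.Subset.antisymm ?_ ?_, Set.Subset.antisymm ?_ ?_⟩
  · have hcl : IsClosed { w : Fin n → ℝ | ∀ f ∈ I, f ≠ 0 → w ∈ V.tropHyp f } := by
      simp only [Set.ofPred_forall]
      exact isClosed_iInter fun f => isClosed_iInter fun _ => isClosed_iInter fun _ =>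
        tv_closed V f
    refine closure_minimal ?_ hcl
    rintro p ⟨u, hu, hI, rfl⟩ f hf hf0
    exact tv_ab V f hf0 u hu (hI f hf)
  · intro w hw
    exact subset_closure (tv_ba V I w hw)
  · intro w hw s hs g hg
    exact tv_bc V I w hw s hs g hg
  · intro w hw f hf hf0
    exact tv_cb V I w hw f hf hf0
end

section
/- Let K be an algebraically closed field with a surjective valuation deg : Kˣ → ℝ, with residue field k, let I ⊆ K[x₁,…,xₙ] be an ideal, let w ∈ ℝⁿ, and fix s₁,…,sₙ ∈ Kˣ with deg sᵢ = wᵢ. If ū ∈ (kˣ)ⁿ is a common zero of the initial ideal in_w(I) ⊆ k[x₁,…,xₙ], then there exists u ∈ (Kˣ)ⁿ with f(u) = 0 for all f ∈ I such that, for each i, deg(uᵢ) = wᵢ and the residue of uᵢ/sᵢ in k equals ūᵢ. In particular, every zero over k of in_w(I) lifts to a zero over K of I. -/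
open scoped Classical

open MvPolynomial

variable {K : Type*} [Field K]

namespace ZL

lemma residue_avoid {K Γ : Type*} [Field K] [IsAlgClosed K] [LinearOrderedCommGroupWithZero Γ]
    (w : Valuation K Γ) (S : Finset K) : ∃ e : K, w e = 1 ∧ ∀ s ∈ S, 1 ≤ w (e - s) := by
  set T := insert 0 (S.filter fun s => w s ≤ 1) with hT
  have hT1 : ∀ s ∈ T, w s ≤ 1 := by
    intro s hs
    simp only [hT, Finset.mem_insert, Finset.mem_filter] at hs
    rcases hs with rfl | hs
    · simp
    · exact hs.2
  obtain ⟨e, he⟩ := IsAlgClosed.exists_root (k := K)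
    ((∏ s ∈ T, (Polynomial.X - Polynomial.C s)) - Polynomial.C 1) (by
      have h1 : (∏ s ∈ T, (Polynomial.X - Polynomial.C s : Polynomial K)).degree = T.card := by
        rw [Polynomial.degree_prod]; simp
      have h2 : 0 < T.card := Finset.card_pos.2 ⟨0, by simp [hT]⟩
      rw [Polynomial.degree_sub_C]
      · rw [h1]; exact_mod_cast h2.ne'
      · rw [h1]; exact_mod_cast h2)
  have hprod : ∏ s ∈ T, (e - s) = 1 := by
    simp only [Polynomial.IsRoot, Polynomial.eval_sub, Polynomial.eval_prod, Polynomial.eval_X,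
      Polynomial.eval_C] at he
    exact sub_eq_zero.1 he
  have hw : ∏ s ∈ T, w (e - s) = 1 := by
    rw [← map_prod, hprod, map_one]
  have hle : w e ≤ 1 := by
    by_contra! h
    have : ∀ s ∈ T, w (e - s) = w e := fun s hs =>
      Valuation.map_sub_eq_of_lt_left w ((hT1 s hs).trans_lt h)
    rw [Finset.prod_congr rfl this, Finset.prod_const] at hw
    exact absurd hw (one_lt_pow₀ h (Finset.card_pos.2 ⟨0, by simp [hT]⟩).ne').ne'
  have hle' : ∀ s ∈ T, w (e - s) ≤ 1 := fun s hs =>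
    (w.map_sub e s).trans (max_le hle (hT1 s hs))
  have hge : ∀ s ∈ T, 1 ≤ w (e - s) := by
    intro s hs
    rw [← Finset.mul_prod_erase _ _ hs] at hw
    have : ∏ x ∈ T.erase s, w (e - x) ≤ 1 :=
      Finset.prod_le_one' fun x hx => hle' x (Finset.mem_of_mem_erase hx)
    rw [← hw]
    exact mul_le_of_le_one_right' this
  refine ⟨e, le_antisymm hle ?_, ?_⟩
  · simpa using hge 0 (by simp [hT])
  · intro s hs
    by_cases h : w s ≤ 1
    · exact hge s (by simp [hT, hs, h])
    · push Not at h
      rw [Valuation.map_sub_eq_of_lt_right w (hle.trans_lt h)]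
      exact h.le

lemma exists_between {K Γ : Type*} [Field K] [IsAlgClosed K] [LinearOrderedCommGroupWithZero Γ]
    (w : Valuation K Γ) (t : K) (ht0 : t ≠ 0) (ht : w t < 1) (L U : Finset K)
    (hU : ∀ u ∈ U, u ≠ 0) (hLU : ∀ l ∈ L, ∀ u ∈ U, w l < w u) :
    ∃ g : K, g ≠ 0 ∧ (∀ l ∈ L, w l < w g) ∧ ∀ u ∈ U, w g < w u := by
  obtain ⟨l, hl, hlmax⟩ := Finset.exists_max_image (insert 0 L) w ⟨0, by simp⟩
  have hlU : ∀ u ∈ U, w l < w u := by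
    intro u hu
    rcases Finset.mem_insert.1 hl with rfl | hl
    · simpa [zero_lt_iff] using hU u hu
    · exact hLU l hl u hu
  suffices h : ∃ g : K, g ≠ 0 ∧ w l < w g ∧ ∀ u ∈ U, w g < w u by
    obtain ⟨g, h0, h1, h2⟩ := h
    exact ⟨g, h0, fun x hx => (hlmax x (Finset.mem_insert_of_mem hx)).trans_lt h1, h2⟩
  have hwt : 0 < w t := by simpa [zero_lt_iff] using ht0
  rcases U.eq_empty_or_nonempty with rfl | hne
  · by_cases h0 : l = 0
    · exact ⟨1, one_ne_zero, by simp [h0], by simp⟩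
    · refine ⟨l * t⁻¹, mul_ne_zero h0 (inv_ne_zero ht0), ?_, by simp⟩
      rw [map_mul, map_inv₀]
      exact lt_mul_of_one_lt_right (by simpa [zero_lt_iff] using h0) ((one_lt_inv₀ hwt).2 ht)
  · obtain ⟨u, hu, humin⟩ := Finset.exists_min_image U w hne
    suffices h : ∃ g : K, g ≠ 0 ∧ w l < w g ∧ w g < w u by
      obtain ⟨g, h0, h1, h2⟩ := h
      exact ⟨g, h0, h1, fun x hx => h2.trans_le (humin x hx)⟩
    have hwu : 0 < w u := by simpa [zero_lt_iff] using hU u hu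
    by_cases h0 : l = 0
    · refine ⟨u * t, mul_ne_zero (hU u hu) ht0, ?_, ?_⟩
      · rw [h0, map_zero, map_mul]; exact mul_pos hwu hwt
      · rw [map_mul]; exact mul_lt_of_lt_one_right hwu ht
    · obtain ⟨g, hg⟩ := IsAlgClosed.exists_pow_nat_eq (l * u) (n := 2) (by norm_num)
      have hwl : 0 < w l := by simpa [zero_lt_iff] using h0
      have hw : w g ^ 2 = w l * w u := by rw [← map_pow, hg, map_mul]
      have hlu := hlU u hu
      refine ⟨g, ?_, ?_, ?_⟩
      · rintro rfl
        exact mul_ne_zero h0 (hU u hu) (by simpa using hg.symm)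
      · refine lt_of_pow_lt_pow_left₀ 2 zero_le ?_
        rw [hw, sq]; exact mul_lt_mul_of_pos_left hlu hwl
      · refine lt_of_pow_lt_pow_left₀ 2 zero_le ?_
        rw [hw, sq]; exact mul_lt_mul_of_pos_right hlu hwu

/-- `γ` is on the same side of `δ` as `ρ`. -/
def Same {Γ : Type*} [LinearOrder Γ] (ρ γ δ : Γ) : Prop :=
  (δ < ρ → δ < γ) ∧ (ρ < δ → γ < δ) ∧ (δ = ρ → δ = γ)

lemma exists_same {K Γ : Type*} [Field K] [IsAlgClosed K] [LinearOrderedCommGroupWithZero Γ]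
    (w : Valuation K Γ) (t : K) (ht0 : t ≠ 0) (ht : w t < 1) (D : Finset K) (ρ : Γ) (hρ : ρ ≠ 0) :
    ∃ g : K, g ≠ 0 ∧ ∀ d ∈ D, Same ρ (w g) (w d) := by
  by_cases h : ∃ g, w g = ρ
  · obtain ⟨g, rfl⟩ := h
    exact ⟨g, by rintro rfl; simp at hρ, fun d _ => ⟨id, id, id⟩⟩
  · push Not at h
    obtain ⟨g, h0, h1, h2⟩ := exists_between w t ht0 ht (D.filter fun d => w d < ρ)
      (D.filter fun d => ρ < w d) (by
        intro u hu
        rw [Finset.mem_filter] at hu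
        rintro rfl
        simp at hu) (by
        intro l hl u hu
        rw [Finset.mem_filter] at hu hl
        exact hl.2.trans hu.2)
    refine ⟨g, h0, fun d hd => ⟨fun hh => h1 d (by simp [hd, hh]),
      fun hh => h2 d (by simp [hd, hh]), fun hh => absurd hh (h d)⟩⟩

lemma mono_ineq {K Γ : Type*} [Field K] [IsAlgClosed K] [LinearOrderedCommGroupWithZero Γ]
    (w : Valuation K Γ) (ρ : Γ) (hρ : ρ ≠ 0) (A B : K) (m l : ℕ)
    (h : w A * ρ ^ m < w B * ρ ^ l) :
    ∃ d : K, ∀ γ : Γ, γ ≠ 0 → Same ρ γ (w d) → w A * γ ^ m < w B * γ ^ l := by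
  have hB : B ≠ 0 := by rintro rfl; simp at h
  have hwB : 0 < w B := by simpa [zero_lt_iff] using hB
  by_cases hA : A = 0
  · refine ⟨0, fun γ hγ _ => ?_⟩
    rw [hA, map_zero, zero_mul]
    exact mul_pos hwB (pow_pos (zero_lt_iff.2 hγ) _)
  have hwA : 0 < w A := by simpa [zero_lt_iff] using hA
  rcases lt_trichotomy m l with hml | rfl | hml
  · obtain ⟨k, rfl⟩ := Nat.exists_eq_add_of_lt hml
    obtain ⟨d, hd⟩ := IsAlgClosed.exists_pow_nat_eq (A / B) (n := k + 1) (by omega)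
    have key : ∀ γ : Γ, γ ≠ 0 → (w A * γ ^ m < w B * γ ^ (m + k + 1) ↔ w d < γ) := by
      intro γ hγ
      have e : w B * γ ^ (m + k + 1) = (w B * γ ^ (k+1)) * γ ^ m := by
        rw [add_assoc, pow_add, mul_assoc, mul_comm (γ ^ m)]
      rw [e, mul_lt_mul_iff_left₀ (pow_pos (zero_lt_iff.2 hγ) _), mul_comm, ← div_lt_iff₀ hwB,
        ← map_div₀, ← hd, map_pow]
      exact pow_lt_pow_iff_left₀ zero_le zero_le (by omega)
    exact ⟨d, fun γ hγ hs => (key γ hγ).2 (hs.1 ((key ρ hρ).1 h))⟩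
  · refine ⟨0, fun γ hγ _ => ?_⟩
    rw [mul_lt_mul_iff_left₀ (pow_pos (zero_lt_iff.2 hρ) _)] at h
    rwa [mul_lt_mul_iff_left₀ (pow_pos (zero_lt_iff.2 hγ) _)]
  · obtain ⟨k, rfl⟩ := Nat.exists_eq_add_of_lt hml
    obtain ⟨d, hd⟩ := IsAlgClosed.exists_pow_nat_eq (B / A) (n := k + 1) (by omega)
    have key : ∀ γ : Γ, γ ≠ 0 → (w A * γ ^ (l + k + 1) < w B * γ ^ l ↔ γ < w d) := by
      intro γ hγ
      have e : w A * γ ^ (l + k + 1) = (w A * γ ^ (k+1)) * γ ^ l := by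
        rw [add_assoc, pow_add, mul_assoc, mul_comm (γ ^ l)]
      rw [e, mul_lt_mul_iff_left₀ (pow_pos (zero_lt_iff.2 hγ) _), mul_comm, ← lt_div_iff₀ hwA,
        ← map_div₀, ← hd, map_pow]
      exact pow_lt_pow_iff_left₀ zero_le zero_le (by omega)
    exact ⟨d, fun γ hγ hs => (key γ hγ).2 (hs.2.1 ((key ρ hρ).1 h))⟩

lemma max_val {K Γ : Type*} [Field K] [LinearOrderedCommGroupWithZero Γ]
    (w : Valuation K Γ) (a b : K) (h : w a ≤ w (a - b)) : w (a - b) = max (w a) (w b) := by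
  refine le_antisymm (w.map_sub a b) (max_le h ?_)
  have : b = a - (a - b) := by ring
  calc w b = w (a - (a - b)) := by rw [← this]
    _ ≤ max (w a) (w (a - b)) := w.map_sub _ _
    _ ≤ _ := max_le h le_rfl

/-- one-variable approximation -/
lemma approx {K E Γ : Type*} [Field K] [IsAlgClosed K] [Field E] [Algebra K E]
    [LinearOrderedCommGroupWithZero Γ] (v : Valuation E Γ)
    (t : K) (ht0 : t ≠ 0) (ht : v (algebraMap K E t) < 1) (y : E)
    {ι : Type*} [Fintype ι] (a b : ι → Polynomial K)
    (h : ∀ i, v (Polynomial.aeval y (a i)) < v (Polynomial.aeval y (b i))) :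
    ∃ c : K, ∀ i, v (algebraMap K E ((a i).eval c)) < v (algebraMap K E ((b i).eval c)) := by
  set w : Valuation K Γ := v.comap (algebraMap K E) with hw
  have hwv : ∀ x, v (algebraMap K E x) = w x := fun x => rfl
  simp only [hwv] at ht ⊢
  set S : Finset K := insert 0 (Finset.univ.biUnion fun i => (a i).roots.toFinset ∪ (b i).roots.toFinset)
    with hS
  obtain ⟨r0, hr0, hmin⟩ := Finset.exists_min_image S (fun r => v (y - algebraMap K E r))
    ⟨0, by simp [hS]⟩
  set ρ := v (y - algebraMap K E r0) with hρd
  by_cases hρ : ρ = 0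
  · have hy : y = algebraMap K E r0 := by
      rw [hρd, map_eq_zero] at hρ; exact sub_eq_zero.1 hρ
    refine ⟨r0, fun i => ?_⟩
    have := h i
    rw [hy, Polynomial.aeval_algebraMap_apply, Polynomial.aeval_algebraMap_apply] at this
    rw [← hwv, ← hwv]
    simpa using this
  -- monomial description
  have hQ : ∀ p : Polynomial K, (∀ r ∈ p.roots, r ∈ S) → ∃ (A : K) (m : ℕ),
      v (Polynomial.aeval y p) = w A * ρ ^ m ∧
      ∀ c : K, (∀ r ∈ S, w (c - r) = max (w (c - r0)) (w (r - r0))) →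
        (∀ r ∈ S, Same ρ (w (c - r0)) (w (r - r0))) → w (p.eval c) = w A * (w (c - r0)) ^ m := by
    intro p hp
    have hs : p = Polynomial.C p.leadingCoeff * (p.roots.map fun r => Polynomial.X - Polynomial.C r).prod :=
      (IsAlgClosed.splits p).eq_prod_roots
    have hms : ∀ s : Multiset K, (∀ r ∈ s, r ∈ S) → ∃ (A : K) (m : ℕ),
      v (Polynomial.aeval y (s.map fun r => Polynomial.X - Polynomial.C r).prod) = w A * ρ ^ m ∧
      ∀ c : K, (∀ r ∈ S, w (c - r) = max (w (c - r0)) (w (r - r0))) →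
        (∀ r ∈ S, Same ρ (w (c - r0)) (w (r - r0))) →
          w ((s.map fun r => Polynomial.X - Polynomial.C r).prod.eval c) = w A * (w (c - r0)) ^ m := by
      intro s
      induction s using Multiset.induction_on with
      | empty => intro _; exact ⟨1, 0, by simp, by simp⟩
      | cons r s ih =>
        intro hrs
        obtain ⟨A, m, h1, h2⟩ := ih fun r hr => hrs r (Multiset.mem_cons_of_mem hr)
        have hr : r ∈ S := hrs r (Multiset.mem_cons_self _ _)
        have hmx : v (y - algebraMap K E r) = max ρ (w (r - r0)) := by
          have := max_val v (y - algebraMap K E r0) (algebraMap K E (r - r0)) (by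
            have := hmin r hr
            simpa using this)
          rw [← hwv, ← this]; simp
        simp only [Multiset.map_cons, Multiset.prod_cons, map_mul, Polynomial.eval_mul, h1,
          Polynomial.aeval_X, Polynomial.aeval_C, map_sub, Polynomial.eval_sub, Polynomial.eval_X,
          Polynomial.eval_C, hmx]
        rcases le_or_gt (w (r - r0)) ρ with hle | hlt
        · refine ⟨A, m + 1, ?_, ?_⟩
          · rw [max_eq_left hle, pow_succ]; ac_rfl
          · intro c hc1 hc2
            have hle' : w (r - r0) ≤ w (c - r0) := by
              rcases hle.lt_or_eq with hh | hh
              · exact ((hc2 r hr).1 hh).le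
              · exact ((hc2 r hr).2.2 hh).le
            rw [h2 c hc1 hc2, hc1 r hr, max_eq_left hle', pow_succ]; ac_rfl
        · refine ⟨(r - r0) * A, m, ?_, ?_⟩
          · rw [max_eq_right hlt.le, map_mul]; ac_rfl
          · intro c hc1 hc2
            have hle' := (hc2 r hr).2.1 hlt
            rw [h2 c hc1 hc2, hc1 r hr, max_eq_right hle'.le, map_mul]; ac_rfl
    obtain ⟨A, m, h1, h2⟩ := hms p.roots hp
    refine ⟨p.leadingCoeff * A, m, ?_, ?_⟩
    · conv_lhs => rw [hs]
      rw [map_mul, map_mul, h1, Polynomial.aeval_C, hwv, map_mul, mul_assoc]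
    · intro c hc1 hc2
      conv_lhs => rw [hs]
      rw [Polynomial.eval_mul, map_mul, h2 c hc1 hc2, Polynomial.eval_C, map_mul, mul_assoc]
  have haS : ∀ i, ∀ r ∈ (a i).roots, r ∈ S := by
    intro i r hr
    rw [hS, Finset.mem_insert, Finset.mem_biUnion]
    exact Or.inr ⟨i, Finset.mem_univ _, by rw [Finset.mem_union]; left; exact Multiset.mem_toFinset.2 hr⟩
  have hbS : ∀ i, ∀ r ∈ (b i).roots, r ∈ S := by
    intro i r hr
    rw [hS, Finset.mem_insert, Finset.mem_biUnion]
    exact Or.inr ⟨i, Finset.mem_univ _, by rw [Finset.mem_union]; right; exact Multiset.mem_toFinset.2 hr⟩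
  choose A m hA1 hA2 using fun i => hQ (a i) (haS i)
  choose B l hB1 hB2 using fun i => hQ (b i) (hbS i)
  have hd : ∀ i, ∃ d : K, ∀ γ : Γ, γ ≠ 0 → Same ρ γ (w d) →
      w (A i) * γ ^ (m i) < w (B i) * γ ^ (l i) := by
    intro i
    apply mono_ineq w ρ hρ
    rw [← hA1, ← hB1]; exact h i
  choose d hd using hd
  obtain ⟨g, hg0, hg⟩ := exists_same w t ht0 ht (Finset.univ.image d ∪ S.image fun r => r - r0) ρ hρ
  obtain ⟨e, he1, he⟩ := residue_avoid w (S.image fun r => (r - r0) / g)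
  have hgw : 0 < w g := by simpa [zero_lt_iff] using hg0
  set c := r0 + e * g with hc
  have hcw : w (c - r0) = w g := by simp [hc, he1]
  refine ⟨c, fun i => ?_⟩
  have hc1 : ∀ r ∈ S, w (c - r) = max (w (c - r0)) (w (r - r0)) := by
    intro r hr
    have := max_val w (c - r0) (r - r0) (by
      rw [hcw]
      have h1 := he ((r - r0) / g) (Finset.mem_image_of_mem _ hr)
      have h2 : c - r0 - (r - r0) = (e - (r - r0) / g) * g := by rw [hc]; field_simp; ring
      rw [h2, map_mul]
      exact le_mul_of_one_le_left hgw.le h1)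
    rw [← this]; congr 1; ring
  have hc2 : ∀ r ∈ S, Same ρ (w (c - r0)) (w (r - r0)) := by
    intro r hr
    rw [hcw]
    exact hg _ (Finset.mem_union_right _ (Finset.mem_image_of_mem _ hr))
  rw [hA2 i c hc1 hc2, hB2 i c hc1 hc2]
  apply hd i
  · rw [hcw]; exact hgw.ne'
  · rw [hcw]; exact hg _ (Finset.mem_union_left _ (Finset.mem_image_of_mem _ (Finset.mem_univ _)))

lemma small_root {E Γ : Type*} [Field E] [LinearOrderedCommGroupWithZero Γ] (v : Valuation E Γ)
    (P : Polynomial E) (hP : P.Monic) (g : E) (hg : P.eval g = 0) (hv : v g < 1) :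
    ∃ j, v (P.coeff 0) < v (P.coeff j) := by
  by_contra! h
  have h0 : P.coeff 0 ≠ 0 := by
    intro h0
    have := h P.natDegree
    rw [hP.coeff_natDegree, h0] at this
    simp at this
  have hpos : 0 < v (P.coeff 0) := by simpa [zero_lt_iff] using h0
  rw [Polynomial.eval_eq_sum_range, Finset.sum_range_succ'] at hg
  have hlt : v (∑ k ∈ Finset.range P.natDegree, P.coeff (k + 1) * g ^ (k + 1)) < v (P.coeff 0) := by
    apply Valuation.map_sum_lt v hpos.ne'
    intro k _
    rw [map_mul, map_pow]
    calc v (P.coeff (k+1)) * v g ^ (k+1) ≤ v (P.coeff 0) * v g ^ (k+1) :=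
          mul_le_mul_left (h (k+1)) _
      _ < v (P.coeff 0) * 1 := by
          apply mul_lt_mul_of_pos_left _ hpos
          exact pow_lt_one₀ zero_le hv (by omega)
      _ = _ := mul_one _
  rw [eq_neg_of_add_eq_zero_left hg, pow_zero, mul_one, Valuation.map_neg] at hlt
  exact lt_irrefl _ hlt

lemma big_roots {K Γ : Type*} [Field K] [LinearOrderedCommGroupWithZero Γ] (w : Valuation K Γ)
    (s : Multiset K) (hs : ∀ r ∈ s, 1 ≤ w r) (j : ℕ) :
    w ((s.map fun r => Polynomial.X - Polynomial.C r).prod.coeff j) ≤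
      w ((s.map fun r => Polynomial.X - Polynomial.C r).prod.coeff 0) := by
  induction s using Multiset.induction_on generalizing j with
  | empty =>
    rw [Multiset.map_zero, Multiset.prod_zero, Polynomial.coeff_one, Polynomial.coeff_one]
    split_ifs <;> simp_all
  | cons r s ih =>
    have ih' := ih fun r hr => hs r (Multiset.mem_cons_of_mem hr)
    have hr := hs r (Multiset.mem_cons_self _ _)
    set Q := (s.map fun r => Polynomial.X - Polynomial.C r).prod
    rw [Multiset.map_cons, Multiset.prod_cons]
    have h0 : w (((Polynomial.X - Polynomial.C r) * Q).coeff 0) = w r * w (Q.coeff 0) := by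
      rw [Polynomial.mul_coeff_zero]; simp
    rw [h0]
    cases j with
    | zero => rw [h0]
    | succ j =>
      rw [sub_mul, Polynomial.coeff_sub, Polynomial.coeff_X_mul, Polynomial.coeff_C_mul]
      refine (w.map_sub _ _).trans (max_le ?_ ?_)
      · exact (ih' j).trans (le_mul_of_one_le_left zero_le hr)
      · rw [map_mul]; exact mul_le_mul_right (ih' _) _

lemma newton {K Γ : Type*} [Field K] [LinearOrderedCommGroupWithZero Γ] (w : Valuation K Γ)
    (n : ℕ) (U : Polynomial K) (hU : U.degree < n) (Z : Finset K) (hZ : n ≤ Z.card)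
    (hZ1 : ∀ z ∈ Z, w z ≤ 1) (hZ2 : ∀ z ∈ Z, ∀ z' ∈ Z, z ≠ z' → 1 ≤ w (z - z'))
    (h : ∀ z ∈ Z, w (U.eval z) < 1) (j : ℕ) : w (U.coeff j) < 1 := by
  induction n generalizing U Z j with
  | zero =>
    have : U = 0 := by
      by_contra h0
      rw [Polynomial.degree_eq_natDegree h0] at hU
      norm_cast at hU
    simp [this]
  | succ n ih =>
    obtain ⟨z, hz⟩ : Z.Nonempty := Finset.card_pos.1 (by omega)
    obtain ⟨U1, hU1⟩ : (Polynomial.X - Polynomial.C z) ∣ U - Polynomial.C (U.eval z) :=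
      Polynomial.X_sub_C_dvd_sub_C_eval
    have hUe : U = Polynomial.C (U.eval z) + (Polynomial.X - Polynomial.C z) * U1 := by
      rw [← hU1]; ring
    have hdeg : U1.degree < n := by
      by_cases h0 : U1 = 0
      · rw [h0, Polynomial.degree_zero]; exact WithBot.bot_lt_coe _
      have h2 : (U - Polynomial.C (U.eval z)).degree < (n + 1 : ℕ) :=
        lt_of_le_of_lt (Polynomial.degree_sub_le _ _) (max_lt hU
          (lt_of_le_of_lt Polynomial.degree_C_le (by exact_mod_cast Nat.succ_pos n)))
      rw [hU1, Polynomial.degree_mul, Polynomial.degree_X_sub_C,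
        Polynomial.degree_eq_natDegree h0] at h2
      rw [Polynomial.degree_eq_natDegree h0]
      norm_cast at h2 ⊢
      omega
    have ih1 := ih U1 hdeg (Z.erase z) (by rw [Finset.card_erase_of_mem hz]; omega)
      (fun x hx => hZ1 x (Finset.mem_of_mem_erase hx))
      (fun x hx x' hx' => hZ2 x (Finset.mem_of_mem_erase hx) x' (Finset.mem_of_mem_erase hx'))
      (by
        intro x hx
        have hxz := Finset.ne_of_mem_erase hx
        have hxZ := Finset.mem_of_mem_erase hx
        have h1 : (x - z) * U1.eval x = U.eval x - U.eval z := by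
          conv_rhs => rw [hUe]
          simp
        have h2 : w ((x - z) * U1.eval x) < 1 := by
          rw [h1]
          exact (w.map_sub _ _).trans_lt (max_lt (h x hxZ) (h z hz))
        rw [map_mul] at h2
        exact lt_of_le_of_lt (le_mul_of_one_le_left zero_le (hZ2 x hxZ z hz hxz)) h2)
    have hz1 : ∀ k, w (z * U1.coeff k) < 1 := by
      intro k
      rw [map_mul]
      exact lt_of_le_of_lt (mul_le_of_le_one_left zero_le (hZ1 z hz)) (ih1 k)
    rw [hUe]
    cases j with
    | zero =>
      rw [Polynomial.coeff_add, sub_mul, Polynomial.coeff_sub, Polynomial.coeff_C_zero,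
        Polynomial.mul_coeff_zero, Polynomial.coeff_X_zero, zero_mul, zero_sub,
        Polynomial.coeff_C_mul]
      refine (w.map_add _ _).trans_lt (max_lt (h z hz) ?_)
      rw [Valuation.map_neg]; exact hz1 0
    | succ j =>
      rw [Polynomial.coeff_add, sub_mul, Polynomial.coeff_sub, Polynomial.coeff_C_succ, zero_add,
        Polynomial.coeff_X_mul, Polynomial.coeff_C_mul]
      exact (w.map_sub _ _).trans_lt (max_lt (ih1 j) (hz1 _))

lemma exists_Z {K Γ : Type*} [Field K] [IsAlgClosed K] [LinearOrderedCommGroupWithZero Γ]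
    (w : Valuation K Γ) (N : ℕ) : ∃ Z : Finset K, Z.card = N ∧ (∀ z ∈ Z, w z ≤ 1) ∧
      ∀ z ∈ Z, ∀ z' ∈ Z, z ≠ z' → 1 ≤ w (z - z') := by
  induction N with
  | zero => exact ⟨∅, by simp⟩
  | succ N ih =>
    obtain ⟨Z, hc, h1, h2⟩ := ih
    obtain ⟨e, he, he'⟩ := residue_avoid w Z
    have heZ : e ∉ Z := fun h => by simpa using he' e h
    refine ⟨insert e Z, by rw [Finset.card_insert_of_notMem heZ, hc], ?_, ?_⟩
    · intro z hz
      rcases Finset.mem_insert.1 hz with rfl | hz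
      · exact he.le
      · exact h1 z hz
    · intro z hz z' hz' hne
      rcases Finset.mem_insert.1 hz with rfl | hz1 <;> rcases Finset.mem_insert.1 hz' with rfl | hz1'
      · exact absurd rfl hne
      · exact he' _ hz1'
      · rw [Valuation.map_sub_swap]; exact he' _ hz1
      · exact h2 z hz1 z' hz1' hne

lemma extend_hom {A C K : Type*} [CommRing A] [CommRing C] [Field K] [IsAlgClosed K]
    [Algebra A C] [Algebra.IsIntegral A C] (hinj : Function.Injective (algebraMap A C))
    (g : A →+* K) : ∃ φ : C →+* K, ∀ a, φ (algebraMap A C a) = g a := by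
  have : (RingHom.ker g).IsPrime := RingHom.ker_isPrime g
  obtain ⟨Q, -, hQ, hQc⟩ := Ideal.exists_ideal_over_prime_of_isIntegral (RingHom.ker g) (⊥ : Ideal C)
    (by
      intro a ha
      have : algebraMap A C a = 0 := by simpa using ha
      rw [map_eq_zero_iff _ hinj] at this
      simp [this])
  let : Algebra A K := g.toAlgebra
  set P := RingHom.ker g with hP
  have : P.IsPrime := RingHom.ker_isPrime g
  have : Q.LiesOver P := ⟨hQc.symm⟩
  let : Algebra (A ⧸ P) K := (Ideal.Quotient.lift P g (fun a ha => ha)).toAlgebra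
  have : FaithfulSMul (A ⧸ P) K := by
    rw [faithfulSMul_iff_algebraMap_injective]
    exact RingHom.lift_injective_of_ker_le_ideal _ _ le_rfl
  have : Algebra.IsIntegral (A ⧸ P) (C ⧸ Q) := inferInstance
  have : FaithfulSMul (A ⧸ P) (C ⧸ Q) := Ideal.Quotient.instFaithfulSMul ..
  have : Module.IsTorsionFree (A ⧸ P) (C ⧸ Q) := Module.isTorsionFree_iff_faithfulSMul.2 this
  have : Module.IsTorsionFree (A ⧸ P) K := Module.isTorsionFree_iff_faithfulSMul.2 inferInstance
  let L : (C ⧸ Q) →ₐ[A ⧸ P] K := IsAlgClosed.lift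
  refine ⟨L.toRingHom.comp (Ideal.Quotient.mk Q), fun a => ?_⟩
  have := L.commutes (Ideal.Quotient.mk P a)
  exact this

lemma spec {K E : Type*} [Field K] [IsAlgClosed K] [Field E] [Algebra K E]
    (y : E) (hy : Transcendental K y) (d : Polynomial K) (hd : Polynomial.aeval y d ≠ 0)
    (c : K) (hc : d.eval c ≠ 0) :
    ∃ (C : Subalgebra K E) (φ : C →ₐ[K] K),
      (∀ p : Polynomial K, ∃ h : Polynomial.aeval y p ∈ C, φ ⟨_, h⟩ = p.eval c) ∧
      (∀ b : E, (∃ a : Polynomial K, Polynomial.aeval y d * b = Polynomial.aeval y a) → b ∈ C) ∧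
      ∀ P : Polynomial E, P.Monic →
        (∀ j, ∃ a : Polynomial K, Polynomial.aeval y d * P.coeff j = Polynomial.aeval y a) →
        ∀ r, P.eval r = 0 → r ∈ C := by
  let A := Localization.Away d
  let fE : A →ₐ[K] E := IsLocalization.liftAlgHom (M := Submonoid.powers d)
    (f := Polynomial.aeval y) (by
      rintro ⟨_, k, rfl⟩
      simpa using IsUnit.pow k (isUnit_iff_ne_zero.2 hd))
  let fK : A →ₐ[K] K := IsLocalization.liftAlgHom (M := Submonoid.powers d)
    (f := Polynomial.aeval c) (by
      rintro ⟨_, k, rfl⟩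
      simpa using IsUnit.pow k (isUnit_iff_ne_zero.2 hc))
  have hfE : ∀ p : Polynomial K, fE (algebraMap _ A p) = Polynomial.aeval y p := fun p => by
    simp [fE]
  have hfK : ∀ p : Polynomial K, fK (algebraMap _ A p) = p.eval c := fun p => by
    simp [fK, Polynomial.aeval_def]
  have hinj : Function.Injective fE := by
    rw [injective_iff_map_eq_zero]
    intro a ha
    obtain ⟨⟨p, s⟩, hps⟩ := IsLocalization.surj (Submonoid.powers d) a
    have h1 : fE (algebraMap _ A p) = 0 := by rw [← hps, map_mul, ha, zero_mul]
    rw [hfE] at h1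
    have hp : p = 0 := by
      rw [transcendental_iff] at hy; exact hy p h1
    have hu : IsUnit (algebraMap (Polynomial K) A s) := IsLocalization.map_units A s
    simp only [hp, map_zero] at hps
    exact hu.mul_left_eq_zero.1 hps
  let algAE : Algebra A E := fE.toRingHom.toAlgebra
  have hmapAE : ∀ a, algebraMap A E a = fE a := fun a => rfl
  have hst : IsScalarTower K A E := IsScalarTower.of_algebraMap_eq fun k => by
    rw [hmapAE]; exact (fE.commutes k).symm
  have hmem : ∀ b : E, (∃ a : Polynomial K, Polynomial.aeval y d * b = Polynomial.aeval y a) →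
      ∃ a : A, algebraMap A E a = b := by
    rintro b ⟨a, hab⟩
    refine ⟨IsLocalization.mk' A a ⟨d, Submonoid.mem_powers d⟩, ?_⟩
    apply mul_left_cancel₀ hd
    rw [hab, ← hfE, ← hfE, hmapAE, ← map_mul, mul_comm]
    congr 1
    exact IsLocalization.mk'_spec A a ⟨d, Submonoid.mem_powers d⟩
  obtain ⟨φ, hφ⟩ := extend_hom (A := A) (C := integralClosure A E) (K := K)
    (by
      intro a b hab
      apply hinj
      exact congrArg (fun z : integralClosure A E => (z : E)) hab) fK.toRingHom
  let C : Subalgebra K E := (integralClosure A E).restrictScalars K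
  have hAC : ∀ a : A, algebraMap A E a ∈ C := fun a => (integralClosure A E).algebraMap_mem a
  have hφ' : ∀ (a : A) (h : algebraMap A E a ∈ C), φ ⟨algebraMap A E a, h⟩ = fK a :=
    fun a h => hφ a
  refine ⟨C, { toRingHom := (φ : C →+* K), commutes' := ?_ }, ?_, ?_, ?_⟩
  · intro k
    have h1 := hφ (algebraMap K A k)
    have h2 : fK (algebraMap K A k) = k := fK.commutes k
    refine Eq.trans ?_ (h1.trans h2)
    change φ _ = φ _
    congr 1
    apply Subtype.ext
    exact IsScalarTower.algebraMap_apply K A E k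
  · intro p
    have h0 : algebraMap A E (algebraMap _ A p) = Polynomial.aeval y p := hfE p
    have h1 : Polynomial.aeval y p ∈ C := h0 ▸ hAC _
    refine ⟨h1, ?_⟩
    rw [← hfK]
    refine Eq.trans ?_ (hφ (algebraMap _ A p))
    change φ _ = φ _
    congr 1
    exact Subtype.ext h0.symm
  · intro b hb
    obtain ⟨a, rfl⟩ := hmem b hb
    exact hAC a
  · intro P hP hco r hr
    have hl : P ∈ Polynomial.lifts (algebraMap A E) := by
      rw [Polynomial.lifts_iff_coeff_lifts]
      exact fun j => hmem _ (hco j)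
    obtain ⟨Q, hQ, -, hQm⟩ := Polynomial.lifts_and_natDegree_eq_and_monic hl hP
    change IsIntegral A r
    refine ⟨Q, hQm, ?_⟩
    rw [← Polynomial.eval_map, hQ, hr]

lemma denom {K E : Type*} [Field K] [Field E] [Algebra K E] (y : E) (D : Finset E)
    (hD : ∀ b ∈ D, b ∈ IntermediateField.adjoin K {y}) :
    ∃ d : Polynomial K, Polynomial.aeval y d ≠ 0 ∧
      ∀ b ∈ D, ∃ a : Polynomial K, Polynomial.aeval y d * b = Polynomial.aeval y a := by
  induction D using Finset.induction_on with
  | empty => exact ⟨1, by simp, by simp⟩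
  | insert b D hb ih =>
    obtain ⟨d, hd, h⟩ := ih fun b hb => hD b (Finset.mem_insert_of_mem hb)
    obtain ⟨r, s, hrs⟩ := (IntermediateField.mem_adjoin_simple_iff K b).1
      (hD b (Finset.mem_insert_self _ _))
    by_cases hs : Polynomial.aeval y s = 0
    · refine ⟨d, hd, fun b' hb' => ?_⟩
      rcases Finset.mem_insert.1 hb' with rfl | hb'
      · exact ⟨0, by rw [hrs, hs]; simp⟩
      · exact h b' hb'
    · refine ⟨s * d, by rw [map_mul]; exact mul_ne_zero hs hd, fun b' hb' => ?_⟩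
      rcases Finset.mem_insert.1 hb' with rfl | hb'
      · exact ⟨d * r, by rw [hrs, map_mul, map_mul]; field_simp⟩
      · obtain ⟨a, ha⟩ := h b' hb'
        exact ⟨s * a, by rw [map_mul, map_mul, ← ha, mul_assoc]⟩

lemma mem_range_of_alg {K E : Type*} [Field K] [IsAlgClosed K] [Field E] [Algebra K E] (x : E)
    (hx : IsAlgebraic K x) : ∃ u : K, algebraMap K E u = x := by
  have := minpoly.mem_range_of_degree_eq_one K x
    (IsAlgClosed.degree_eq_one_of_irreducible K (minpoly.irreducible hx.isIntegral))
  exact this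

lemma trdeg1 {K E Γ : Type*} [Field K] [IsAlgClosed K] [Field E] [IsAlgClosed E] [Algebra K E]
    [LinearOrderedCommGroupWithZero Γ] (v : Valuation E Γ)
    (t : K) (ht0 : t ≠ 0) (ht : v (algebraMap K E t) < 1) (y : E) (n : ℕ) (x : Fin n → E)
    (hx : ∀ i, IsAlgebraic (IntermediateField.adjoin K {y}) (x i)) (hv : ∀ i, v (x i) < 1) :
    ∃ u : Fin n → K, (∀ i, v (algebraMap K E (u i)) < 1) ∧
      ∀ f : MvPolynomial (Fin n) K, aeval x f = 0 → eval u f = 0 := by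
  by_cases hy : IsAlgebraic K y
  · have : Algebra.IsAlgebraic K (IntermediateField.adjoin K {y}) :=
      IntermediateField.isAlgebraic_adjoin_simple hy.isIntegral
    choose u hu using fun i => mem_range_of_alg (K := K) (x i) ((hx i).restrictScalars K)
    refine ⟨u, fun i => by rw [hu]; exact hv i, fun f hf => ?_⟩
    have hxu : x = algebraMap K E ∘ u := funext fun i => (hu i).symm
    rw [hxu] at hf
    have := MvPolynomial.aeval_algebraMap_apply E u f
    rw [hf] at this
    have h2 := (map_eq_zero_iff _ (algebraMap K E).injective).1 this.symm
    simpa [MvPolynomial.aeval_eq_eval] using h2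
  let F := IntermediateField.adjoin K {y}
  let w : Valuation K Γ := v.comap (algebraMap K E)
  have hwv : ∀ x, v (algebraMap K E x) = w x := fun x => rfl
  let L := IntermediateField.adjoin F (Set.range x)
  have hfin : FiniteDimensional F L := by
    have := (Set.finite_range x).to_subtype
    apply IntermediateField.finiteDimensional_adjoin
    rintro _ ⟨i, rfl⟩
    exact (hx i).isIntegral
  let X : Fin n → L := fun i => ⟨x i, IntermediateField.subset_adjoin F _ ⟨i, rfl⟩⟩
  obtain ⟨Z, hZc, hZ1, hZ2⟩ := exists_Z w (Fintype.card (L →ₐ[F] E) * n + 1)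
  let g : K → L := fun z => ∑ i : Fin n, algebraMap K L z ^ (i : ℕ) * X i
  let P : K → Polynomial E := fun z => (minpoly F (g z)).map (algebraMap F E)
  let Q : Fin n → Polynomial E := fun i => (minpoly F (X i)).map (algebraMap F E)
  have hint : ∀ l : L, IsIntegral F l := fun l => Algebra.IsIntegral.isIntegral l
  have hPm : ∀ z, (P z).Monic := fun z => (minpoly.monic (hint _)).map _
  have hQm : ∀ i, (Q i).Monic := fun i => (minpoly.monic (hint _)).map _
  have hroot : ∀ (l : L) (σ : L →ₐ[F] E),
      ((minpoly F l).map (algebraMap F E)).eval (σ l) = 0 := by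
    intro l σ
    rw [Polynomial.eval_map, ← Polynomial.aeval_def, Polynomial.aeval_algHom_apply, minpoly.aeval,
      map_zero]
  have hgE : ∀ z, ((g z : L) : E) = ∑ i : Fin n, algebraMap K E z ^ (i : ℕ) * x i := by
    intro z
    have h1 : ∀ l : L, (l : E) = L.val l := fun l => rfl
    rw [h1, map_sum]
    apply Finset.sum_congr rfl
    intro i _
    rw [map_mul, map_pow]
    rfl
  have hgσ : ∀ z (σ : L →ₐ[F] E), σ (g z) = ∑ i : Fin n, algebraMap K E z ^ (i : ℕ) * σ (X i) := by
    intro z σ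
    rw [map_sum]
    apply Finset.sum_congr rfl
    intro i _
    rw [map_mul, map_pow]
    congr 2
    exact (σ.restrictScalars K).commutes z
  have hj : ∀ z ∈ Z, ∃ j, v ((P z).coeff 0) < v ((P z).coeff j) := by
    intro z hz
    refine small_root v (P z) (hPm z) _ (hroot (g z) L.val) ?_
    change v ((g z : L) : E) < 1
    rw [hgE]
    apply Valuation.map_sum_lt v one_ne_zero
    intro i _
    rw [map_mul, map_pow, hwv]
    exact lt_of_le_of_lt (mul_le_of_le_one_left zero_le (pow_le_one₀ zero_le (hZ1 z hz))) (hv i)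
  choose! j hj using hj
  -- common denominator
  obtain ⟨d, hd, hden⟩ := denom (K := K) y
    ((Z.biUnion fun z => (Finset.range ((P z).natDegree + 1)).image (P z).coeff) ∪
      (Finset.univ.biUnion fun i => (Finset.range ((Q i).natDegree + 1)).image (Q i).coeff)) (by
      intro b hb
      rw [Finset.mem_union, Finset.mem_biUnion, Finset.mem_biUnion] at hb
      rcases hb with ⟨z, -, hb⟩ | ⟨i, -, hb⟩ <;>
      · obtain ⟨k, -, rfl⟩ := Finset.mem_image.1 hb
        simp only [P, Q, Polynomial.coeff_map]
        exact SetLike.coe_mem _)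
  have hgen : ∀ R : Polynomial E, (∀ k ∈ Finset.range (R.natDegree + 1),
      ∃ a : Polynomial K, Polynomial.aeval y d * R.coeff k = Polynomial.aeval y a) →
      ∀ k, ∃ a : Polynomial K, Polynomial.aeval y d * R.coeff k = Polynomial.aeval y a := by
    intro R hR k
    by_cases hk : k < R.natDegree + 1
    · exact hR k (Finset.mem_range.2 hk)
    · exact ⟨0, by rw [Polynomial.coeff_eq_zero_of_natDegree_lt (by omega)]; simp⟩
  have hPd : ∀ z ∈ Z, ∀ k, ∃ a : Polynomial K,
      Polynomial.aeval y d * (P z).coeff k = Polynomial.aeval y a := by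
    intro z hz
    refine hgen _ fun k hk => hden _ ?_
    exact Finset.mem_union_left _ (Finset.mem_biUnion.2 ⟨z, hz, Finset.mem_image_of_mem _ hk⟩)
  have hQd : ∀ i, ∀ k, ∃ a : Polynomial K,
      Polynomial.aeval y d * (Q i).coeff k = Polynomial.aeval y a := by
    intro i
    refine hgen _ fun k hk => hden _ ?_
    exact Finset.mem_union_right _
      (Finset.mem_biUnion.2 ⟨i, Finset.mem_univ _, Finset.mem_image_of_mem _ hk⟩)
  choose! a ha using hPd
  obtain ⟨c, hc⟩ := approx v t ht0 ht y
    (ι := Option Z) (fun o => o.elim 0 fun z => a z 0) (fun o => o.elim d fun z => a z (j z)) (by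
      rintro (_ | ⟨z, hz⟩)
      · simpa [zero_lt_iff] using hd
      · simp only [Option.elim]
        rw [← ha z hz, ← ha z hz, map_mul, map_mul]
        exact mul_lt_mul_of_pos_left (hj z hz) (by simpa [zero_lt_iff] using hd))
  have hdc : d.eval c ≠ 0 := by
    have := hc none
    intro h0
    simp [h0] at this
  have hcz : ∀ z ∈ Z, w ((a z 0).eval c) < w ((a z (j z)).eval c) := fun z hz => hc (some ⟨z, hz⟩)
  obtain ⟨C, φ, hφ1, hC1, hC2⟩ := spec y hy d hd c hdc
  have hXC : ∀ (σ : L →ₐ[F] E) i, σ (X i) ∈ C := fun σ i =>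
    hC2 (Q i) (hQm i) (hQd i) _ (hroot (X i) σ)
  let U : (L →ₐ[F] E) → Fin n → K := fun σ i => φ ⟨σ (X i), hXC σ i⟩
  have hrel : ∀ σ, ∀ f : MvPolynomial (Fin n) K, aeval x f = 0 → eval (U σ) f = 0 := by
    intro σ f hf
    have h1 : aeval X f = 0 := by
      apply L.val.injective
      rw [map_zero, ← hf]
      have := (MvPolynomial.comp_aeval_apply X (L.val.restrictScalars K) f).symm
      exact this.symm
    have h2 : aeval (fun i => (⟨σ (X i), hXC σ i⟩ : C)) f = 0 := by
      apply Subtype.val_injective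
      have h3 := (MvPolynomial.comp_aeval_apply (fun i => (⟨σ (X i), hXC σ i⟩ : C)) C.val f).symm
      have h4 := (MvPolynomial.comp_aeval_apply X (σ.restrictScalars K) f).symm
      rw [h1, map_zero] at h4
      refine h3.symm.trans (Eq.trans ?_ h4)
      rfl
    have h5 := (MvPolynomial.comp_aeval_apply (fun i => (⟨σ (X i), hXC σ i⟩ : C)) φ f).symm
    rw [h2, map_zero] at h5
    rw [← MvPolynomial.aeval_eq_eval]
    exact h5
  have hmain : ∀ z ∈ Z, ∃ σ : L →ₐ[F] E, w (∑ i : Fin n, z ^ (i : ℕ) * U σ i) < 1 := by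
    intro z hz
    by_contra! hcon
    have hsplit : P z = ((P z).roots.map fun r => Polynomial.X - Polynomial.C r).prod :=
      (IsAlgClosed.splits (P z)).eq_prod_roots_of_monic (hPm z)
    have hrσ : ∀ r ∈ (P z).roots, ∃ σ : L →ₐ[F] E, σ (g z) = r := by
      intro r hr
      have h1 : r ∈ (minpoly F (g z)).rootSet E := by
        rw [Polynomial.mem_rootSet]
        refine ⟨minpoly.ne_zero (hint _), ?_⟩
        rw [Polynomial.aeval_def, ← Polynomial.eval_map]
        exact (Polynomial.mem_roots'.1 hr).2
      rw [← Algebra.IsAlgebraic.range_eval_eq_rootSet_minpoly] at h1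
      exact h1
    have hgC : ∀ σ : L →ₐ[F] E, σ (g z) ∈ C := fun σ =>
      hC2 (P z) (hPm z) (ha z hz · |> fun h => ⟨_, h⟩) _ (hroot (g z) σ)
    obtain ⟨s, hs⟩ : ∃ s : Multiset C, s.map C.val = (P z).roots := by
      have : ∀ r ∈ (P z).roots, r ∈ C := by
        intro r hr
        obtain ⟨σ, rfl⟩ := hrσ r hr
        exact hgC σ
      refine ⟨(P z).roots.attach.map (fun r => ⟨r.1, this r.1 r.2⟩), ?_⟩
      rw [Multiset.map_map]
      exact Multiset.attach_map_val _
    let PC : Polynomial C := (s.map fun r => Polynomial.X - Polynomial.C r).prod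
    have hPC : PC.map C.val.toRingHom = P z := by
      rw [hsplit, ← hs, Polynomial.map_multiset_prod, Multiset.map_map, Multiset.map_map]
      congr 1
      apply Multiset.map_congr rfl
      intro r _
      simp
    have hφs : PC.map φ.toRingHom =
        ((s.map φ).map fun r => Polynomial.X - Polynomial.C r).prod := by
      rw [Polynomial.map_multiset_prod, Multiset.map_map, Multiset.map_map]
      congr 1
      apply Multiset.map_congr rfl
      intro r _
      simp
    have hco : ∀ k, d.eval c * φ (PC.coeff k) = (a z k).eval c := by
      intro k
      obtain ⟨h1, h1'⟩ := hφ1 d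
      obtain ⟨h2, h2'⟩ := hφ1 (a z k)
      rw [← h1', ← h2', ← map_mul]
      congr 1
      apply Subtype.ext
      change Polynomial.aeval y d * C.val (PC.coeff k) = Polynomial.aeval y (a z k)
      rw [← ha z hz k, ← hPC, Polynomial.coeff_map]
      rfl
    have hbig := big_roots w (s.map φ) (by
      intro r hr
      obtain ⟨r', hr', rfl⟩ := Multiset.mem_map.1 hr
      obtain ⟨σ, hσ⟩ := hrσ r' (by rw [← hs]; exact Multiset.mem_map_of_mem _ hr')
      have h1 : r' = ∑ i : Fin n, algebraMap K C z ^ (i : ℕ) * (⟨σ (X i), hXC σ i⟩ : C) := by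
        apply Subtype.val_injective
        change (r' : E) = C.val _
        rw [← hσ, hgσ, map_sum]
        apply Finset.sum_congr rfl
        intro i _
        rw [map_mul, map_pow]
        rfl
      have h2 : φ r' = ∑ i : Fin n, z ^ (i : ℕ) * U σ i := by
        rw [h1, map_sum]
        apply Finset.sum_congr rfl
        intro i _
        rw [map_mul, map_pow, AlgHom.commutes]
        rfl
      rw [h2]
      exact hcon σ) (j z)
    rw [← hφs, Polynomial.coeff_map, Polynomial.coeff_map] at hbig
    have hlt := hcz z hz
    rw [← hco, ← hco, map_mul, map_mul] at hlt
    exact absurd (lt_of_mul_lt_mul_left hlt zero_le) (not_lt.2 hbig)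
  choose! τ hτ using hmain
  obtain ⟨σ, -, hσ⟩ := Finset.exists_lt_card_fiber_of_mul_lt_card_of_maps_to (s := Z)
    (t := (Finset.univ : Finset (L →ₐ[F] E))) (f := τ) (n := n) (fun _ _ => Finset.mem_univ _)
    (by rw [hZc, Finset.card_univ]; omega)
  refine ⟨U σ, fun i => ?_, hrel σ⟩
  let W : Polynomial K := ∑ i : Fin n, Polynomial.C (U σ i) * Polynomial.X ^ (i : ℕ)
  have hWc : ∀ i : Fin n, W.coeff i = U σ i := by
    intro i
    simp only [W, Polynomial.finsetSum_coeff, Polynomial.coeff_C_mul, Polynomial.coeff_X_pow]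
    rw [Finset.sum_eq_single i]
    · simp
    · intro b _ hb
      rw [if_neg, mul_zero]
      exact fun h => hb (Fin.ext h.symm)
    · simp
  have := newton w n W (Polynomial.degree_sum_fin_lt _) (Z.filter fun z => τ z = σ) hσ.le
    (fun z hz => hZ1 z (Finset.mem_filter.1 hz).1)
    (fun z hz z' hz' => hZ2 z (Finset.mem_filter.1 hz).1 z' (Finset.mem_filter.1 hz').1)
    (fun z hz => by
      obtain ⟨h1, h2⟩ := Finset.mem_filter.1 hz
      have h3 := hτ z h1
      rw [h2] at h3
      have : W.eval z = ∑ i : Fin n, z ^ (i : ℕ) * U σ i := by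
        simp only [W, Polynomial.eval_finsetSum, Polynomial.eval_mul, Polynomial.eval_C,
          Polynomial.eval_pow, Polynomial.eval_X]
        exact Finset.sum_congr rfl fun i _ => mul_comm _ _
      rw [this]; exact h3) i
  rw [hWc] at this
  exact this

lemma trdeg_all {K E Γ : Type*} [Field K] [IsAlgClosed K] [Field E] [IsAlgClosed E] [Algebra K E]
    [LinearOrderedCommGroupWithZero Γ] (v : Valuation E Γ)
    (t : K) (ht0 : t ≠ 0) (ht : v (algebraMap K E t) < 1) (n : ℕ) (S : Finset E) :
    ∀ x : Fin n → E, (∀ i, IsAlgebraic (IntermediateField.adjoin K (S : Set E)) (x i)) →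
      (∀ i, v (x i) < 1) →
    ∃ u : Fin n → K, (∀ i, v (algebraMap K E (u i)) < 1) ∧
      ∀ f : MvPolynomial (Fin n) K, aeval x f = 0 → eval u f = 0 := by
  induction S using Finset.induction_on with
  | empty =>
    intro x hx hv
    refine trdeg1 v t ht0 ht 0 n x (fun i => ?_) hv
    refine IsAlgebraic.tower_top_of_subalgebra_le
      (A := (IntermediateField.adjoin K ((∅ : Finset E) : Set E)).toSubalgebra)
      (B := (IntermediateField.adjoin K {(0 : E)}).toSubalgebra) ?_ (hx i)
    exact IntermediateField.adjoin.mono K _ _ (by simp)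
  | insert a S' _ ih =>
    intro x hx hv
    let F := IntermediateField.adjoin K (S' : Set E)
    let K1 := algebraicClosure F E
    have hst : IsScalarTower K K1 E := IsScalarTower.of_algebraMap_eq fun _ => rfl
    have hcl : IsAlgClosed K1 := (algebraicClosure.isAlgClosure F E).isAlgClosed
    obtain ⟨u, hu1, hu2⟩ := trdeg1 (K := K1) v (algebraMap K K1 t)
      (by simpa using ht0) (by
        rw [← IsScalarTower.algebraMap_apply]; exact ht) a n x (fun i => by
        refine IsAlgebraic.tower_top_of_subalgebra_le
          (A := (IntermediateField.adjoin K ((insert a S' : Finset E) : Set E)).toSubalgebra)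
          (B := ((IntermediateField.adjoin K1 {a}).restrictScalars K).toSubalgebra) ?_ (hx i)
        change IntermediateField.adjoin K ((insert a S' : Finset E) : Set E) ≤
          (IntermediateField.adjoin K1 {a}).restrictScalars K
        rw [IntermediateField.adjoin_le_iff]
        intro b hb
        rw [Finset.coe_insert] at hb
        rcases hb with rfl | hb
        · exact IntermediateField.mem_adjoin_simple_self K1 _
        · have hbF : b ∈ F := IntermediateField.subset_adjoin K _ hb
          have h1 : algebraMap F E ⟨b, hbF⟩ ∈ K1 := K1.algebraMap_mem _
          exact (IntermediateField.adjoin K1 {a}).algebraMap_mem (⟨b, h1⟩ : K1)) hv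
    obtain ⟨u', h1, h2⟩ := ih (fun i => (u i : E))
      (fun i => mem_algebraicClosure_iff.1 (u i).2) hu1
    refine ⟨u', h1, fun f hf => h2 f ?_⟩
    have h3 := hu2 (MvPolynomial.map (algebraMap K K1) f) (by
      rw [MvPolynomial.aeval_map_algebraMap]; exact hf)
    have h4 : aeval u f = 0 := by
      rw [MvPolynomial.eval_map] at h3
      exact h3
    have h5 := MvPolynomial.aeval_algebraMap_apply E u f
    rw [h4, map_zero] at h5
    exact h5

lemma MK_prime {K : Type*} [Field K] (V : ValData K) : V.MK.IsPrime := by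
  constructor
  · intro h
    have h1 : (1 : V.RK) ∈ V.MK := by rw [h]; trivial
    have h2 : 0 < V.deg (1 : K) := h1 one_ne_zero
    rw [V.deg_one] at h2
    exact lt_irrefl _ h2
  · rintro ⟨a, ha⟩ ⟨b, hb⟩ hab
    by_contra! hcon
    obtain ⟨h1, h2⟩ := hcon
    have h1' : ¬ (a ≠ 0 → 0 < V.deg a) := h1
    have h2' : ¬ (b ≠ 0 → 0 < V.deg b) := h2
    push Not at h1' h2'
    have h3 : 0 < V.deg (a * b) := hab (mul_ne_zero h1'.1 h2'.1)
    rw [V.deg_mul _ _ h1'.1 h2'.1] at h3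
    linarith [h1'.2, h2'.2]

lemma res_coe {K : Type*} [Field K] (V : ValData K) (c : V.RK) :
    V.res (c : K) = Ideal.Quotient.mk V.MK c := by
  unfold ValData.res
  rw [dif_pos c.2]

lemma reduce_map {K : Type*} [Field K] (V : ValData K) {n : ℕ} (f : MvPolynomial (Fin n) V.RK) :
    V.reduce (MvPolynomial.map V.RK.subtype f) = MvPolynomial.map (Ideal.Quotient.mk V.MK) f := by
  ext a
  unfold ValData.reduce
  rw [MvPolynomial.coeff_sum]
  simp only [MvPolynomial.coeff_monomial, MvPolynomial.coeff_map]
  rw [Finset.sum_ite_eq']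
  split_ifs with h
  · exact res_coe V _
  · rw [MvPolynomial.notMem_support_iff, MvPolynomial.coeff_map] at h
    have : MvPolynomial.coeff a f = 0 := Subtype.ext h
    rw [this, map_zero]

lemma coeff_scale {K : Type*} [Field K] {n : ℕ} (r : Fin n → K) (f : MvPolynomial (Fin n) K)
    (a : Fin n →₀ ℕ) :
    MvPolynomial.coeff a (bind₁ (fun i => C (r i) * (X i : MvPolynomial (Fin n) K)) f) =
      MvPolynomial.coeff a f * ∏ i ∈ a.support, r i ^ a i := by
  induction f using MvPolynomial.induction_on' with
  | add p q hp hq => rw [map_add, coeff_add, coeff_add, hp, hq, add_mul]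
  | monomial d c =>
    rw [bind₁_monomial]
    have h1 : ∏ i ∈ d.support, (C (r i) * (X i : MvPolynomial (Fin n) K)) ^ d i =
        C (∏ i ∈ d.support, r i ^ d i) * monomial d 1 := by
      rw [MvPolynomial.monomial_eq, C_1, one_mul, map_prod, Finsupp.prod, ← Finset.prod_mul_distrib]
      exact Finset.prod_congr rfl fun i _ => by rw [mul_pow, C_pow]
    rw [h1, ← mul_assoc, ← C_mul, C_mul_monomial, mul_one, coeff_monomial, coeff_monomial]
    split_ifs with h
    · rw [h]
    · rw [zero_mul]

lemma deg_prod {K : Type*} [Field K] (V : ValData K) {n : ℕ} (w : Fin n → ℝ) (s : Fin n → K)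
    (hs : ∀ i, s i ≠ 0 ∧ V.deg (s i) = w i) (a : Fin n → ℕ) (T : Finset (Fin n)) :
    V.deg (∏ i ∈ T, (s i)⁻¹ ^ a i) + ∑ i ∈ T, (a i : ℝ) * w i = 0 := by
  have hinv : ∀ i, V.deg ((s i)⁻¹) = - w i := by
    intro i
    have := V.deg_mul _ _ (hs i).1 (inv_ne_zero (hs i).1)
    rw [mul_inv_cancel₀ (hs i).1, V.deg_one, (hs i).2] at this
    linarith
  have hpow : ∀ i (m : ℕ), V.deg ((s i)⁻¹ ^ m) = - (m * w i) := by
    intro i m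
    induction m with
    | zero => simp [V.deg_one]
    | succ m ih =>
      rw [pow_succ, V.deg_mul _ _ (pow_ne_zero _ (inv_ne_zero (hs i).1)) (inv_ne_zero (hs i).1),
        ih, hinv]
      push_cast; ring
  induction T using Finset.induction_on with
  | empty => simp [V.deg_one]
  | insert b T hb ih =>
    rw [Finset.prod_insert hb, Finset.sum_insert hb, V.deg_mul _ _
      (pow_ne_zero _ (inv_ne_zero (hs b).1))
      (Finset.prod_ne_zero_iff.2 fun i _ => pow_ne_zero _ (inv_ne_zero (hs i).1)), hpow]
    linarith

lemma scale_inv {K : Type*} [Field K] {n : ℕ} (r s : Fin n → K) (h : ∀ i, r i * s i = 1)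
    (f : MvPolynomial (Fin n) K) :
    bind₁ (fun i => C (s i) * (X i : MvPolynomial (Fin n) K))
      (bind₁ (fun i => C (r i) * (X i : MvPolynomial (Fin n) K)) f) = f := by
  ext a
  rw [coeff_scale, coeff_scale, mul_assoc, ← Finset.prod_mul_distrib]
  rw [Finset.prod_eq_one, mul_one]
  intro i _
  rw [← mul_pow, h, one_pow]

lemma disj {K : Type*} [Field K] (V : ValData K) (n : ℕ)
    (I : Ideal (MvPolynomial (Fin n) K)) (w : Fin n → ℝ)
    (s : Fin n → K) (hs : ∀ i, s i ≠ 0 ∧ V.deg (s i) = w i)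
    (ubar : Fin n → V.kk)
    (hz : ∀ g ∈ V.inwIdeal w s I, eval ubar g = 0) (f : MvPolynomial (Fin n) V.RK)
    (hf : bind₁ (fun i => C ((s i)⁻¹) * (X i : MvPolynomial (Fin n) K))
      (MvPolynomial.map V.RK.subtype f) ∈ I) :
    eval ubar (MvPolynomial.map (Ideal.Quotient.mk V.MK) f) = 0 := by
  by_cases hall : ∀ a, MvPolynomial.coeff a f ∈ V.MK
  · have : MvPolynomial.map (Ideal.Quotient.mk V.MK) f = 0 := by
      ext a
      rw [coeff_map, coeff_zero]
      exact Ideal.Quotient.eq_zero_iff_mem.2 (hall a)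
    rw [this, map_zero]
  push Not at hall
  obtain ⟨a, ha⟩ := hall
  have ha' : ¬ (((MvPolynomial.coeff a f : V.RK) : K) ≠ 0 → 0 < V.deg ((MvPolynomial.coeff a f : V.RK) : K)) := ha
  push Not at ha'
  obtain ⟨ha0, ha1⟩ := ha'
  set g := bind₁ (fun i => C ((s i)⁻¹) * (X i : MvPolynomial (Fin n) K))
      (MvPolynomial.map V.RK.subtype f) with hg
  have hco : ∀ b, MvPolynomial.coeff b g =
      ((MvPolynomial.coeff b f : V.RK) : K) * ∏ i ∈ b.support, (s i)⁻¹ ^ b i := by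
    intro b
    rw [hg, coeff_scale, coeff_map]; rfl
  have hsupp : ∀ b ∈ g.support, ((MvPolynomial.coeff b f : V.RK) : K) ≠ 0 := by
    intro b hb
    rw [mem_support_iff, hco] at hb
    exact left_ne_zero_of_mul hb
  have hne : ∀ b : Fin n →₀ ℕ, ∏ i ∈ b.support, (s i)⁻¹ ^ b i ≠ 0 := fun b =>
    Finset.prod_ne_zero_iff.2 fun i _ => pow_ne_zero _ (inv_ne_zero (hs i).1)
  have hw : ∀ b, ((MvPolynomial.coeff b f : V.RK) : K) ≠ 0 →
      V.termWeight w g b = V.deg ((MvPolynomial.coeff b f : V.RK) : K) := by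
    intro b hb
    unfold ValData.termWeight
    rw [hco, V.deg_mul _ _ hb (hne b), Finsupp.sum]
    linarith [deg_prod V w s hs b b.support]
  have hag : a ∈ g.support := by
    rw [mem_support_iff, hco]
    exact mul_ne_zero ha0 (hne a)
  have h1 := hz _ (Ideal.subset_span ⟨g, hf, by rintro h0; simp [h0] at hag, 1, one_ne_zero, ?_, ?_,
    rfl⟩)
  · rw [inv_one, C_1, one_mul, hg, scale_inv _ _ (fun i => inv_mul_cancel₀ (hs i).1),
      reduce_map] at h1
    exact h1
  · intro b hb
    rw [hw b (hsupp b hb), V.deg_one]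
    exact (MvPolynomial.coeff b f).2 (hsupp b hb)
  · refine ⟨a, hag, ?_⟩
    rw [hw a ha0, V.deg_one]
    exact le_antisymm ((MvPolynomial.coeff a f).2 ha0) ha1

lemma exists_E {A : Type} [CommRing A] (J : Ideal A) (hJ : J.IsPrime) :
    ∃ (E : Type) (_ : Field E) (_ : IsAlgClosed E) (q : A →+* E), ∀ f, q f = 0 ↔ f ∈ J := by
  refine ⟨AlgebraicClosure (FractionRing (A ⧸ J)), inferInstance, inferInstance,
    ((algebraMap (FractionRing (A ⧸ J)) _).comp (algebraMap (A ⧸ J) _)).comp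
      (Ideal.Quotient.mk J), fun f => ?_⟩
  rw [RingHom.comp_apply, RingHom.comp_apply, map_eq_zero,
    map_eq_zero_iff _ (IsFractionRing.injective (A ⧸ J) (FractionRing (A ⧸ J))),
    Ideal.Quotient.eq_zero_iff_mem]

lemma exists_B {P E k : Type*} [CommRing P] [Field E] [CommRing k] [Nontrivial k]
    (θ : P →+* E) (ψ : P →+* k) (h : ∀ f, θ f = 0 → ψ f = 0) :
    ∃ B : ValuationSubring E, (∀ f, B.valuation (θ f) ≤ 1) ∧
      ∀ f, ψ f = 0 → B.valuation (θ f) < 1 := by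
  obtain ⟨B, hB1, hB2⟩ := Ideal.image_subset_nonunits_valuationSubring (A := θ.range)
    ((RingHom.ker ψ).map θ.rangeRestrict) (by
      rw [Ne, Ideal.eq_top_iff_one, Ideal.mem_map_iff_of_surjective _ θ.rangeRestrict_surjective]
      rintro ⟨f, hf, h1⟩
      have h2 : θ f = 1 := congrArg Subtype.val h1
      have h3 := h (f - 1) (by rw [map_sub, h2, map_one, sub_self])
      rw [map_sub, (RingHom.mem_ker).1 hf, map_one, zero_sub, neg_eq_zero] at h3
      exact one_ne_zero h3)
  refine ⟨B, fun f => ?_, fun f hf => ?_⟩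
  · rw [ValuationSubring.valuation_le_one_iff]
    exact hB1 ⟨f, rfl⟩
  · rw [← ValuationSubring.mem_nonunits_iff]
    exact hB2 ⟨θ.rangeRestrict f, Ideal.mem_map_of_mem _ hf, rfl⟩

end ZL

/-- over an algebraically closed field `K` with a surjective real valuation,
every zero over the residue field `k` of the initial ideal `in_w(I)` lifts to a zero over `K`
of `I`: if `ū ∈ (kˣ)ⁿ` is a common zero of `in_w(I)`, then there is `u ∈ (Kˣ)ⁿ` with
`f(u) = 0` for all `f ∈ I`, `deg uᵢ = wᵢ`, and residue of `uᵢ/sᵢ` equal to `ūᵢ` for all `i`. -/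
theorem zero_of_initial_ideal_lifts {K : Type} [Field K] [IsAlgClosed K]
    (V : ValData K) (n : ℕ) (I : Ideal (MvPolynomial (Fin n) K)) (w : Fin n → ℝ)
    (s : Fin n → K) (hs : ∀ i, s i ≠ 0 ∧ V.deg (s i) = w i)
    (ubar : Fin n → V.kk) (hubar : ∀ i, ubar i ≠ 0)
    (hz : ∀ g ∈ V.inwIdeal w s I, eval ubar g = 0) :
    ∃ u : Fin n → K, (∀ i, u i ≠ 0) ∧ (∀ f ∈ I, eval u f = 0) ∧
      ∀ i, V.deg (u i) = w i ∧ V.res (u i / s i) = ubar i := by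
  have hprime := ZL.MK_prime V
  have hdom : IsDomain V.kk := Ideal.Quotient.isDomain V.MK
  let ψ : MvPolynomial (Fin n) V.RK →+* V.kk :=
    (eval ubar).comp (MvPolynomial.map (Ideal.Quotient.mk V.MK))
  let ι : MvPolynomial (Fin n) V.RK →+* MvPolynomial (Fin n) K := MvPolynomial.map V.RK.subtype
  let T : Submonoid (MvPolynomial (Fin n) K) := ((nonZeroDivisors V.kk).comap ψ).map ι
  let I' : Ideal (MvPolynomial (Fin n) K) :=
    I.comap (bind₁ (fun i => C ((s i)⁻¹) * (X i : MvPolynomial (Fin n) K)))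
  have hdis : Disjoint (I' : Set (MvPolynomial (Fin n) K)) (T : Set (MvPolynomial (Fin n) K)) := by
    rw [Set.disjoint_left]
    rintro _ hF ⟨f, hf, rfl⟩
    exact nonZeroDivisors.ne_zero hf (ZL.disj V n I w s hs ubar hz f hF)
  obtain ⟨J, hJ, hIJ, hJT⟩ := Ideal.exists_le_prime_disjoint I' T hdis
  obtain ⟨E, _, _, q, hq⟩ := ZL.exists_E J hJ
  obtain ⟨B, hB1, hB2⟩ := ZL.exists_B (q.comp ι) ψ (by
    intro f hf
    by_contra hne
    exact Set.disjoint_left.1 hJT ((hq _).1 hf) ⟨f, mem_nonZeroDivisors_of_ne_zero hne, rfl⟩)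
  letI : Algebra K E := (q.comp C).toAlgebra
  have hal : ∀ c : K, algebraMap K E c = q (C c) := fun c => rfl
  have hR : ∀ c : V.RK, B.valuation (algebraMap K E c) ≤ 1 := by
    intro c
    have := hB1 (C c)
    simpa [ι, hal] using this
  have hM : ∀ c : V.RK, c ∈ V.MK → B.valuation (algebraMap K E c) < 1 := by
    intro c hc
    have := hB2 (C c) (by simpa [ψ] using Ideal.Quotient.eq_zero_iff_mem.2 hc)
    simpa [ι, hal] using this
  have hM' : ∀ c : K, B.valuation (algebraMap K E c) < 1 → c ≠ 0 → 0 < V.deg c := by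
    intro c hc hc0
    by_contra! hneg
    have h1 := V.deg_mul _ _ hc0 (inv_ne_zero hc0)
    rw [mul_inv_cancel₀ hc0, V.deg_one] at h1
    have h2 := hR ⟨c⁻¹, fun _ => by linarith⟩
    rw [map_inv₀, map_inv₀] at h2
    have h3 : B.valuation (algebraMap K E c) ≠ 0 := by simpa using hc0
    exact absurd hc (not_lt.2 ((inv_le_one₀ (zero_lt_iff.2 h3)).1 h2))
  obtain ⟨t, ht0, ht1⟩ := V.surj 1
  choose c hc using fun i => Ideal.Quotient.mk_surjective (ubar i)
  let x : Fin n → E := fun i => q (X i) - algebraMap K E (c i)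
  obtain ⟨u', hu1, hu2⟩ := ZL.trdeg_all (K := K) B.valuation t ht0
    (hM ⟨t, fun _ => by linarith⟩ (fun _ => by change 0 < V.deg t; linarith)) n
    (Finset.univ.image x) x
    (fun i => by
      have hmem : x i ∈ IntermediateField.adjoin K ((Finset.univ.image x : Finset E) : Set E) :=
        IntermediateField.subset_adjoin K _ (by simp)
      exact isAlgebraic_algebraMap (⟨x i, hmem⟩ :
        IntermediateField.adjoin K ((Finset.univ.image x : Finset E) : Set E)))
    (fun i => by
      have := hB2 (X i - C (c i)) (by simp [ψ, hc])
      simpa [ι, x, hal] using this)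
  have hq2 : ∀ f : MvPolynomial (Fin n) K, aeval (fun i => q (X i)) f = q f := by
    intro f
    have : ((aeval (fun i => q (X i)) : MvPolynomial (Fin n) K →ₐ[K] E) :
        MvPolynomial (Fin n) K →+* E) = q := by
      apply MvPolynomial.ringHom_ext
      · intro r; simp [hal]
      · intro i; simp
    exact RingHom.congr_fun this f
  have huM : ∀ i, u' i ≠ 0 → 0 < V.deg (u' i) := fun i => hM' _ (hu1 i)
  let b : Fin n → V.RK := fun i => c i + ⟨u' i, fun h => (huM i h).le⟩
  have hb : ∀ i, Ideal.Quotient.mk V.MK (b i) = ubar i := by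
    intro i
    have : Ideal.Quotient.mk V.MK ⟨u' i, fun h => (huM i h).le⟩ = 0 :=
      Ideal.Quotient.eq_zero_iff_mem.2 (huM i)
    rw [map_add, this, add_zero, hc]
  have hbM : ∀ i, b i ∉ V.MK := by
    intro i h
    exact hubar i (by rw [← hb, Ideal.Quotient.eq_zero_iff_mem]; exact h)
  have hb0 : ∀ i, (b i : K) ≠ 0 ∧ V.deg (b i : K) = 0 := by
    intro i
    have h1 : ¬ ((b i : K) ≠ 0 → 0 < V.deg (b i : K)) := hbM i
    push Not at h1
    exact ⟨h1.1, le_antisymm h1.2 ((b i).2 h1.1)⟩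
  refine ⟨fun i => s i * (b i : K), fun i => mul_ne_zero (hs i).1 (hb0 i).1, fun f hf => ?_,
    fun i => ⟨?_, ?_⟩⟩
  · have h1 := hu2 (bind₁ (fun i => C (s i) * (C (c i : K) + X i)) f) (by
      have h2 : bind₁ (fun i => C (s i) * (X i : MvPolynomial (Fin n) K)) f ∈ J := by
        apply hIJ
        rw [Ideal.mem_comap, ZL.scale_inv _ _ (fun i => mul_inv_cancel₀ (hs i).1)]
        exact hf
      rw [← hq, ← hq2, aeval_bind₁] at h2
      rw [aeval_bind₁, ← h2]
      congr 2
      funext i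
      simp [x])
    rw [← MvPolynomial.aeval_eq_eval] at h1 ⊢
    rw [← h1]
    change _ = aeval u' _
    rw [aeval_bind₁]
    change aeval _ f = _
    congr 2
    funext i
    simp [b]
  · rw [V.deg_mul _ _ (hs i).1 (hb0 i).1, (hb0 i).2, (hs i).2, add_zero]
  · rw [mul_div_cancel_left₀ _ (hs i).1, ZL.res_coe, hb]
end
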